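/- arXiv:1006.3470 — 2 statements merged into one kernel-verified Lean document; each statement's English description precedes it below -/
import Mathlib

section
/- Let u be a smooth solution of the Adkins–Nappi equivariant wave equation on [−1,0) × [0,∞) with u(t,0) = 0, u(t,r) → π as r → ∞, and finite conserved energy, whose first possible singularity occurs at (t,r) = (0,0). Then u is continuous at the origin with lim_{(t,r)→(0,0), t<0, 0≤r} u(t,r) = 0. -/
open Real MeasureTheory Set Filter Topology

/-- Time derivative `u_t`. -/
noncomputable def ut (u : ℝ → ℝ → ℝ) (t r : ℝ) : ℝ := deriv (fun s => u s r) t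

/-- Radial derivative `u_r`. -/
noncomputable def ur (u : ℝ → ℝ → ℝ) (t r : ℝ) : ℝ := deriv (fun s => u t s) r

/-- Second time derivative `u_tt`. -/
noncomputable def utt (u : ℝ → ℝ → ℝ) (t r : ℝ) : ℝ := deriv (fun s => ut u s r) t

/-- Second radial derivative `u_rr`. -/
noncomputable def urr (u : ℝ → ℝ → ℝ) (t r : ℝ) : ℝ := deriv (fun s => ur u t s) r

/-- Null derivative `u₊ = u_t + u_r`. -/
noncomputable def uplus (u : ℝ → ℝ → ℝ) (t r : ℝ) : ℝ := ut u t r + ur u t r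

/-- Null derivative `u₋ = u_t - u_r`. -/
noncomputable def uminus (u : ℝ → ℝ → ℝ) (t r : ℝ) : ℝ := ut u t r - ur u t r

/-- The Adkins–Nappi equivariant wave equation at the point `(t, r)`. -/
def ANeq (u : ℝ → ℝ → ℝ) (t r : ℝ) : Prop :=
  utt u t r - urr u t r - (2 / r) * ur u t r + Real.sin (2 * u t r) / r ^ 2 +
      (u t r - Real.sin (u t r) * Real.cos (u t r)) * (1 - Real.cos (2 * u t r)) / r ^ 4 = 0

/-- The energy density `e(t,r)`. -/
noncomputable def eDens (u : ℝ → ℝ → ℝ) (t r : ℝ) : ℝ :=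
  (1 / 2) * (ut u t r ^ 2 + ur u t r ^ 2) + Real.sin (u t r) ^ 2 / r ^ 2 +
    (u t r - Real.sin (u t r) * Real.cos (u t r)) ^ 2 / (2 * r ^ 4)

/-- The open half-strip `-1 < t < 0`, `0 < r`. -/
def halfStrip : Set (ℝ × ℝ) := Ioo (-1) 0 ×ˢ Ioi 0

lemma isOpen_halfStrip : IsOpen halfStrip := isOpen_Ioo.prod isOpen_Ioi

lemma fderiv_apply_one_zero {F : ℝ × ℝ → ℝ} {t r : ℝ} (h : DifferentiableAt ℝ F (t, r)) :
    HasDerivAt (fun s => F (s, r)) (fderiv ℝ F (t, r) (1, 0)) t :=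
  h.hasFDerivAt.comp_hasDerivAt t ((hasDerivAt_id t).prodMk (hasDerivAt_const t r))

lemma fderiv_apply_zero_one {F : ℝ × ℝ → ℝ} {t r : ℝ} (h : DifferentiableAt ℝ F (t, r)) :
    HasDerivAt (fun s => F (t, s)) (fderiv ℝ F (t, r) (0, 1)) r :=
  h.hasFDerivAt.comp_hasDerivAt r ((hasDerivAt_const r t).prodMk (hasDerivAt_id r))

lemma fderiv_apply_eq {F : ℝ × ℝ → ℝ} (p : ℝ × ℝ) (x y : ℝ) :
    fderiv ℝ F p (x, y) = x * fderiv ℝ F p (1, 0) + y * fderiv ℝ F p (0, 1) := by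
  have : ((x, y) : ℝ × ℝ) = x • (1, 0) + y • (0, 1) := by simp
  rw [this, map_add, map_smul, map_smul]; simp

/-- Divergence theorem in a region of `halfStrip` bounded by two lines `r = a₀ + a₁ t`,
`r = b₀ + b₁ t`, as an inequality when the divergence is bounded below. -/
lemma trapezoid_lower_bound {F G : ℝ × ℝ → ℝ} (hF : ContDiffOn ℝ 1 F halfStrip)
    (hG : ContDiffOn ℝ 1 G halfStrip) {t₀ t₁ a₀ a₁ b₀ b₁ c w : ℝ} (ht₀ : -1 < t₀) (ht : t₀ ≤ t₁)
    (ht₁ : t₁ < 0) (hc : 0 ≤ c)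
    (ha : ∀ t ∈ Icc t₀ t₁, 0 < a₀ + a₁ * t)
    (hab : ∀ t ∈ Icc t₀ t₁, a₀ + a₁ * t ≤ b₀ + b₁ * t)
    (hw : ∀ t ∈ Icc t₀ t₁, b₀ + b₁ * t - (a₀ + a₁ * t) ≤ w)
    (hS : ∀ t ∈ Icc t₀ t₁, ∀ r ∈ Icc (a₀ + a₁ * t) (b₀ + b₁ * t),
      -c ≤ deriv (fun s => F (s, r)) t - deriv (fun s => G (t, s)) r) :
    (∫ t in t₀..t₁, (G (t, b₀ + b₁ * t) + b₁ * F (t, b₀ + b₁ * t)))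
      - (∫ t in t₀..t₁, (G (t, a₀ + a₁ * t) + a₁ * F (t, a₀ + a₁ * t)))
      - c * w * (t₁ - t₀) ≤
    (∫ r in (a₀ + a₁ * t₁)..(b₀ + b₁ * t₁), F (t₁, r)) -
      ∫ r in (a₀ + a₁ * t₀)..(b₀ + b₁ * t₀), F (t₀, r) := by
  set φ : ℝ × ℝ → ℝ × ℝ := fun q =>
    (q.1, a₀ + a₁ * q.1 + (b₀ + b₁ * q.1 - (a₀ + a₁ * q.1)) * q.2) with hφ
  have hφs : ContDiff ℝ 1 φ := by fun_prop
  have hVo : IsOpen (φ ⁻¹' halfStrip) := isOpen_halfStrip.preimage hφs.continuous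
  have hmaps : ∀ t ∈ Icc t₀ t₁, ∀ s ∈ Icc (0 : ℝ) 1, (φ (t, s)).2 ∈
      Icc (a₀ + a₁ * t) (b₀ + b₁ * t) := by
    intro t ht s hs
    have h1 := hab t ht
    have : 0 ≤ (b₀ + b₁ * t - (a₀ + a₁ * t)) * s := mul_nonneg (by linarith) hs.1
    have h2 : (b₀ + b₁ * t - (a₀ + a₁ * t)) * s ≤ (b₀ + b₁ * t - (a₀ + a₁ * t)) * 1 :=
      mul_le_mul_of_nonneg_left hs.2 (by linarith)
    exact ⟨by simp only [hφ]; linarith, by simp only [hφ]; linarith⟩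
  have hrect : Icc t₀ t₁ ×ˢ Icc (0 : ℝ) 1 ⊆ φ ⁻¹' halfStrip := by
    rintro ⟨t, s⟩ ⟨h1, h2⟩
    exact ⟨⟨by linarith [h1.1], by linarith [h1.2]⟩,
      lt_of_lt_of_le (ha t h1) (hmaps t h1 s h2).1⟩
  set P : ℝ × ℝ → ℝ := fun q => (b₀ + b₁ * q.1 - (a₀ + a₁ * q.1)) * F (φ q) with hP
  set Q : ℝ × ℝ → ℝ := fun q => -(G (φ q) + (a₁ + (b₁ - a₁) * q.2) * F (φ q)) with hQ
  have hFφ : ContDiffOn ℝ 1 (fun q => F (φ q)) (φ ⁻¹' halfStrip) :=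
    hF.comp hφs.contDiffOn (fun _ h => h)
  have hGφ : ContDiffOn ℝ 1 (fun q => G (φ q)) (φ ⁻¹' halfStrip) :=
    hG.comp hφs.contDiffOn (fun _ h => h)
  have hPs : ContDiffOn ℝ 1 P (φ ⁻¹' halfStrip) :=
    ContDiffOn.mul (by fun_prop) hFφ
  have hQs : ContDiffOn ℝ 1 Q (φ ⁻¹' halfStrip) :=
    (hGφ.add (ContDiffOn.mul (by fun_prop) hFφ)).neg
  have hPd := hPs.continuousOn_fderiv_of_isOpen hVo le_rfl
  have hQd := hQs.continuousOn_fderiv_of_isOpen hVo le_rfl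
  have hdiv : ∀ t ∈ Icc t₀ t₁, ∀ s ∈ Icc (0 : ℝ) 1,
      fderiv ℝ P (t, s) (1, 0) + fderiv ℝ Q (t, s) (0, 1) =
      (b₀ + b₁ * t - (a₀ + a₁ * t)) * (deriv (fun x => F (x, (φ (t, s)).2)) t
        - deriv (fun x => G (t, x)) (φ (t, s)).2) := by
    intro t h1 s h2
    have hm : φ (t, s) ∈ halfStrip := hrect ⟨h1, h2⟩
    have hV : φ ⁻¹' halfStrip ∈ 𝓝 (t, s) := hVo.mem_nhds hm
    have hFd : DifferentiableAt ℝ F (φ (t, s)) :=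
      (hF.contDiffAt (isOpen_halfStrip.mem_nhds hm)).differentiableAt one_ne_zero
    have hGd : DifferentiableAt ℝ G (φ (t, s)) :=
      (hG.contDiffAt (isOpen_halfStrip.mem_nhds hm)).differentiableAt one_ne_zero
    have e1 := fderiv_apply_one_zero ((hPs.contDiffAt hV).differentiableAt one_ne_zero)
    have e2 := fderiv_apply_zero_one ((hQs.contDiffAt hV).differentiableAt one_ne_zero)
    have d1 : HasDerivAt (fun x => φ (x, s)) (1, a₁ + (b₁ - a₁) * s) t := by
      refine (hasDerivAt_id t).prodMk ?_
      have := (((hasDerivAt_id t).const_mul a₁).const_add a₀).add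
        (((((hasDerivAt_id t).const_mul b₁).const_add b₀).sub
          (((hasDerivAt_id t).const_mul a₁).const_add a₀)).mul_const s)
      exact this.congr_deriv (by ring)
    have d2 : HasDerivAt (fun x => φ (t, x)) (0, b₀ + b₁ * t - (a₀ + a₁ * t)) s := by
      refine (hasDerivAt_const s t).prodMk ?_
      have := ((hasDerivAt_id s).const_mul (b₀ + b₁ * t - (a₀ + a₁ * t))).const_add (a₀ + a₁ * t)
      exact this.congr_deriv (by ring)
    have F1 := hFd.hasFDerivAt.comp_hasDerivAt t d1
    have F2 := hFd.hasFDerivAt.comp_hasDerivAt s d2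
    have G2 := hGd.hasFDerivAt.comp_hasDerivAt s d2
    have w1 : HasDerivAt (fun x => b₀ + b₁ * x - (a₀ + a₁ * x)) (b₁ - a₁) t := by
      have := (((hasDerivAt_id t).const_mul b₁).const_add b₀).sub
          (((hasDerivAt_id t).const_mul a₁).const_add a₀)
      exact this.congr_deriv (by ring)
    have w2 : HasDerivAt (fun x => a₁ + (b₁ - a₁) * x) (b₁ - a₁) s := by
      have := ((hasDerivAt_id s).const_mul (b₁ - a₁)).const_add a₁
      exact this.congr_deriv (by ring)
    have E1 := e1.unique (w1.mul F1)
    have E2 := e2.unique (G2.add (w2.mul F2)).neg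
    have D1 : deriv (fun x => F (x, (φ (t, s)).2)) t = fderiv ℝ F (φ (t, s)) (1, 0) :=
      (fderiv_apply_one_zero (t := t) (r := (φ (t, s)).2) hFd).deriv
    have D2 : deriv (fun x => G (t, x)) (φ (t, s)).2 = fderiv ℝ G (φ (t, s)) (0, 1) :=
      (fderiv_apply_zero_one (t := t) (r := (φ (t, s)).2) hGd).deriv
    rw [E1, E2, D1, D2, fderiv_apply_eq _ 1, fderiv_apply_eq _ 0 (b₀ + _ - _),
      fderiv_apply_eq _ 0 (b₀ + _ - _)]
    simp only [Function.comp]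
    ring
  have hcont : ContinuousOn (fun x => fderiv ℝ P x (1, 0) + fderiv ℝ Q x (0, 1))
      (Icc t₀ t₁ ×ˢ Icc (0 : ℝ) 1) :=
    ((hPd.clm_apply continuousOn_const).add (hQd.clm_apply continuousOn_const)).mono hrect
  have key := integral2_divergence_prod_of_hasFDerivAt P Q (fderiv ℝ P) (fderiv ℝ Q) t₀ 0 t₁ 1
    (by rw [uIcc_of_le ht, uIcc_of_le zero_le_one]; exact hPs.continuousOn.mono hrect)
    (by rw [uIcc_of_le ht, uIcc_of_le zero_le_one]; exact hQs.continuousOn.mono hrect)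
    (fun x hx => by
      rw [min_eq_left ht, max_eq_right ht, min_eq_left zero_le_one, max_eq_right zero_le_one] at hx
      exact ((hPs.contDiffAt (hVo.mem_nhds (hrect (prod_mono Ioo_subset_Icc_self
        Ioo_subset_Icc_self hx)))).differentiableAt one_ne_zero).hasFDerivAt)
    (fun x hx => by
      rw [min_eq_left ht, max_eq_right ht, min_eq_left zero_le_one, max_eq_right zero_le_one] at hx
      exact ((hQs.contDiffAt (hVo.mem_nhds (hrect (prod_mono Ioo_subset_Icc_self
        Ioo_subset_Icc_self hx)))).differentiableAt one_ne_zero).hasFDerivAt)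
    (by rw [uIcc_of_le ht, uIcc_of_le zero_le_one]
        exact hcont.integrableOn_compact (isCompact_Icc.prod isCompact_Icc))
  have hw0 : 0 ≤ w := by
    have := hab t₀ ⟨le_rfl, ht⟩
    linarith [hw t₀ ⟨le_rfl, ht⟩]
  have hinner : ∀ t ∈ Icc t₀ t₁, -(c * w) ≤
      ∫ s in (0 : ℝ)..1, fderiv ℝ P (t, s) (1, 0) + fderiv ℝ Q (t, s) (0, 1) := by
    intro t h1
    have hci : ContinuousOn (fun s => fderiv ℝ P (t, s) (1, 0) + fderiv ℝ Q (t, s) (0, 1))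
        (Icc (0 : ℝ) 1) :=
      hcont.comp (f := fun s : ℝ => (t, s)) (by fun_prop) (fun s hs => ⟨h1, hs⟩)
    have := intervalIntegral.integral_mono_on (μ := volume) (a := 0) (b := 1) (f := fun _ : ℝ => -(c * w))
      zero_le_one intervalIntegrable_const (hci.intervalIntegrable_of_Icc zero_le_one) (fun s hs => by
        rw [hdiv t h1 s hs]
        have q1 := hS t h1 _ (hmaps t h1 s hs)
        have q2 := hab t h1
        have q3 := hw t h1
        nlinarith [mul_le_mul_of_nonneg_left q1 (sub_nonneg.2 q2),
          mul_le_mul_of_nonneg_left q3 hc])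
    simpa using this
  have hint : IntervalIntegrable (fun t => ∫ s in (0 : ℝ)..1,
      fderiv ℝ P (t, s) (1, 0) + fderiv ℝ Q (t, s) (0, 1)) volume t₀ t₁ := by
    rw [intervalIntegrable_iff_integrableOn_Ioc_of_le ht]
    have hI := (hcont.integrableOn_compact (μ := volume.prod volume)
      (isCompact_Icc.prod isCompact_Icc)).mono_set (prod_mono (Ioc_subset_Icc_self (a := t₀) (b := t₁))
        (Ioc_subset_Icc_self (a := (0 : ℝ)) (b := 1)))
    rw [IntegrableOn, ← Measure.prod_restrict] at hI
    have := hI.integral_prod_left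
    simp only [intervalIntegral.integral_of_le zero_le_one]
    exact this
  have houter := intervalIntegral.integral_mono_on (μ := volume) (f := fun _ => -(c * w)) ht
    intervalIntegrable_const hint
    hinner
  rw [key, intervalIntegral.integral_const, smul_eq_mul] at houter
  have hs : ∀ t, (∫ s in (0 : ℝ)..1, P (t, s)) =
      ∫ r in (a₀ + a₁ * t)..(b₀ + b₁ * t), F (t, r) := by
    intro t
    have := intervalIntegral.mul_integral_comp_add_mul (a := 0) (b := 1) (f := fun r => F (t, r))
      (b₀ + b₁ * t - (a₀ + a₁ * t)) (a₀ + a₁ * t)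
    simp only [mul_zero, mul_one, add_zero, add_sub_cancel] at this
    rw [← this, ← intervalIntegral.integral_const_mul]
  rw [hs, hs] at houter
  have hq1 : (∫ t in t₀..t₁, Q (t, 1)) =
      -∫ t in t₀..t₁, (G (t, b₀ + b₁ * t) + b₁ * F (t, b₀ + b₁ * t)) := by
    rw [← intervalIntegral.integral_neg]
    simp only [hQ, hφ, mul_one, add_sub_cancel]
  have hq0 : (∫ t in t₀..t₁, Q (t, 0)) =
      -∫ t in t₀..t₁, (G (t, a₀ + a₁ * t) + a₁ * F (t, a₀ + a₁ * t)) := by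
    rw [← intervalIntegral.integral_neg]
    simp only [hQ, hφ, mul_zero, add_zero]
  rw [hq1, hq0] at houter
  linarith

/-- The function `x - sin x cos x` occurring in the Skyrme term. -/
noncomputable def skyrme (x : ℝ) : ℝ := x - Real.sin x * Real.cos x

/-- The primitive `(x² - sin² x) / 2` of `skyrme`. -/
noncomputable def skyrmePrim (x : ℝ) : ℝ := (x ^ 2 - Real.sin x ^ 2) / 2

/-- The potential part of the radial energy density. -/
noncomputable def potDens (u : ℝ → ℝ → ℝ) (p : ℝ × ℝ) : ℝ :=
  Real.sin (u p.1 p.2) ^ 2 + skyrme (u p.1 p.2) ^ 2 / (2 * p.2 ^ 2)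

/-- The radial energy density `r² e`. -/
noncomputable def enDens (u : ℝ → ℝ → ℝ) (p : ℝ × ℝ) : ℝ :=
  1 / 2 * p.2 ^ 2 * (ut u p.1 p.2 ^ 2 + ur u p.1 p.2 ^ 2) + potDens u p

/-- The radial momentum density `r² u_t u_r`. -/
noncomputable def momDens (u : ℝ → ℝ → ℝ) (p : ℝ × ℝ) : ℝ :=
  p.2 ^ 2 * ut u p.1 p.2 * ur u p.1 p.2

/-- The outgoing part `r² (e - u_t u_r)` of the energy density, which is also the density of the
energy flux through ingoing null cones. -/
noncomputable def outDens (u : ℝ → ℝ → ℝ) (p : ℝ × ℝ) : ℝ :=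
  1 / 2 * p.2 ^ 2 * uminus u p.1 p.2 ^ 2 + potDens u p

/-- The density on ingoing null cones arising from the radial momentum identity. -/
noncomputable def coneDens (u : ℝ → ℝ → ℝ) (p : ℝ × ℝ) : ℝ :=
  1 / 2 * p.2 ^ 2 * uminus u p.1 p.2 ^ 2 + 1 / 2 * (p.2 * uminus u p.1 p.2 - u p.1 p.2) ^ 2

/-- The density of the modified radial momentum identity. -/
noncomputable def radDens (u : ℝ → ℝ → ℝ) (p : ℝ × ℝ) : ℝ :=
  outDens u p - p.2 * u p.1 p.2 * ut u p.1 p.2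

/-- The flux of the modified radial momentum identity. -/
noncomputable def radFlux (u : ℝ → ℝ → ℝ) (p : ℝ × ℝ) : ℝ :=
  -(1 / 2) * p.2 ^ 2 * uminus u p.1 p.2 ^ 2 + potDens u p - p.2 * u p.1 p.2 * ur u p.1 p.2
    - u p.1 p.2 ^ 2 / 2

/-- The density of the scaling identity. -/
noncomputable def scalDens (u : ℝ → ℝ → ℝ) (p : ℝ × ℝ) : ℝ :=
  -p.1 * enDens u p - p.2 * momDens u p - p.2 ^ 2 * u p.1 p.2 * ut u p.1 p.2

/-- The flux of the scaling identity. -/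
noncomputable def scalFlux (u : ℝ → ℝ → ℝ) (p : ℝ × ℝ) : ℝ :=
  -p.1 * momDens u p - p.2 * (1 / 2 * p.2 ^ 2 * (ut u p.1 p.2 ^ 2 + ur u p.1 p.2 ^ 2)
    - potDens u p) - p.2 ^ 2 * u p.1 p.2 * ur u p.1 p.2

/-- A solution of the Adkins–Nappi equation, regular on the axis before `t = 0`, whose energy is
bounded by `E`. -/
structure FiniteEnergyWave (u : ℝ → ℝ → ℝ) (E : ℝ) : Prop where
  contDiffOn : ContDiffOn ℝ 1 (fun p : ℝ × ℝ => u p.1 p.2) halfStrip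
  contDiffOn_ut : ContDiffOn ℝ 1 (fun p : ℝ × ℝ => ut u p.1 p.2) halfStrip
  contDiffOn_ur : ContDiffOn ℝ 1 (fun p : ℝ × ℝ => ur u p.1 p.2) halfStrip
  hasDerivAt_t : ∀ t r, (t, r) ∈ halfStrip → HasDerivAt (fun s => u s r) (ut u t r) t
  hasDerivAt_r : ∀ t r, (t, r) ∈ halfStrip → HasDerivAt (fun s => u t s) (ur u t r) r
  second : ∀ t r, (t, r) ∈ halfStrip → ∃ l,
    HasDerivAt (fun s => ut u s r) (utt u t r) t ∧ HasDerivAt (fun s => ut u t s) l r ∧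
    HasDerivAt (fun s => ur u s r) l t ∧ HasDerivAt (fun s => ur u t s) (urr u t r) r
  eqn : ∀ t r, (t, r) ∈ halfStrip → ANeq u t r
  axis : ∀ t₁, t₁ < 0 → ∃ K, 0 ≤ K ∧ ∀ t r, -1 < t → t ≤ t₁ → 0 < r → r ≤ 1 / 2 →
    |u t r| ≤ K * r ∧ |ut u t r| ≤ K ∧ |ur u t r| ≤ K
  energy_nonneg : 0 ≤ E
  energy : ∀ t a b, -1 < t → t < 0 → 0 < a → a ≤ b → ∫ r in a..b, enDens u (t, r) ≤ E

lemma enDens_nonneg (u : ℝ → ℝ → ℝ) (p : ℝ × ℝ) : 0 ≤ enDens u p := by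
  unfold enDens potDens; positivity

lemma finiteEnergyWave_of_regular {u : ℝ → ℝ → ℝ}
    (hreg : ContDiffOn ℝ (⊤ : ℕ∞) (fun p : ℝ × ℝ => u p.1 p.2)
      ((Set.Icc (-1 : ℝ) 0 ×ˢ Set.Ici (0 : ℝ)) \ {((0 : ℝ), (0 : ℝ))}))
    (hPDE : ∀ t ∈ Set.Ico (-1 : ℝ) 0, ∀ r : ℝ, 0 < r → ANeq u t r)
    (hbc0 : ∀ t ∈ Set.Ico (-1 : ℝ) 0, u t 0 = 0)
    (hfin : ∀ t ∈ Set.Ico (-1 : ℝ) 0, IntegrableOn (fun r => eDens u t r * r ^ 2) (Set.Ioi 0))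
    (hcons : ∀ t ∈ Set.Ico (-1 : ℝ) 0,
      ∫ r in Set.Ioi (0 : ℝ), eDens u t r * r ^ 2 =
        ∫ r in Set.Ioi (0 : ℝ), eDens u (-1 : ℝ) r * r ^ 2) :
    FiniteEnergyWave u (∫ r in Set.Ioi (0 : ℝ), eDens u (-1 : ℝ) r * r ^ 2) := by
  set U : ℝ × ℝ → ℝ := fun p => u p.1 p.2 with hU
  have hsub : halfStrip ⊆ (Icc (-1 : ℝ) 0 ×ˢ Ici (0 : ℝ)) \ {((0 : ℝ), (0 : ℝ))} := by
    rintro ⟨t, r⟩ ⟨⟨h1, h2⟩, h3⟩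
    refine ⟨⟨⟨h1.le, h2.le⟩, (mem_Ioi.1 h3).le⟩, ?_⟩
    simp only [mem_singleton_iff, Prod.mk.injEq, not_and]
    intro h; exact absurd h h2.ne
  have hUs : ContDiffOn ℝ (⊤ : ℕ∞) U halfStrip := hreg.mono hsub
  have hUd : ∀ p ∈ halfStrip, DifferentiableAt ℝ U p := fun p hp =>
    (hUs.contDiffAt (isOpen_halfStrip.mem_nhds hp)).differentiableAt (by simp)
  have dt : ∀ t r, (t, r) ∈ halfStrip → HasDerivAt (fun s => u s r) (fderiv ℝ U (t, r) (1, 0)) t :=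
    fun t r hp => fderiv_apply_one_zero (hUd _ hp)
  have dr : ∀ t r, (t, r) ∈ halfStrip → HasDerivAt (fun s => u t s) (fderiv ℝ U (t, r) (0, 1)) r :=
    fun t r hp => fderiv_apply_zero_one (hUd _ hp)
  have eqt : ∀ p ∈ halfStrip, ut u p.1 p.2 = fderiv ℝ U p (1, 0) := fun p hp => (dt _ _ hp).deriv
  have eqr : ∀ p ∈ halfStrip, ur u p.1 p.2 = fderiv ℝ U p (0, 1) := fun p hp => (dr _ _ hp).deriv
  have hfd : ContDiffOn ℝ 1 (fderiv ℝ U) halfStrip :=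
    hUs.fderiv_of_isOpen isOpen_halfStrip (by norm_cast)
  have cv : ContDiffOn ℝ 1 (fun p : ℝ × ℝ => ut u p.1 p.2) halfStrip :=
    (hfd.clm_apply contDiffOn_const).congr eqt
  have cw : ContDiffOn ℝ 1 (fun p : ℝ × ℝ => ur u p.1 p.2) halfStrip :=
    (hfd.clm_apply contDiffOn_const).congr eqr
  have dfd : ∀ p ∈ halfStrip, DifferentiableAt ℝ (fderiv ℝ U) p := fun p hp =>
    (hfd.contDiffAt (isOpen_halfStrip.mem_nhds hp)).differentiableAt one_ne_zero
  refine ⟨hUs.of_le (by norm_cast), cv, cw, ?_, ?_, ?_, ?_, ?_, ?_, ?_⟩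
  · intro t r hp; have := dt t r hp; rwa [← eqt _ hp] at this
  · intro t r hp; have := dr t r hp; rwa [← eqr _ hp] at this
  · intro t r hp
    have hn := isOpen_halfStrip.mem_nhds hp
    have dv : DifferentiableAt ℝ (fun p : ℝ × ℝ => ut u p.1 p.2) (t, r) :=
      (cv.contDiffAt hn).differentiableAt one_ne_zero
    have dw : DifferentiableAt ℝ (fun p : ℝ × ℝ => ur u p.1 p.2) (t, r) :=
      (cw.contDiffAt hn).differentiableAt one_ne_zero
    have ev : fderiv ℝ (fun p : ℝ × ℝ => ut u p.1 p.2) (t, r) (0, 1) =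
        fderiv ℝ (fderiv ℝ U) (t, r) (0, 1) (1, 0) := by
      have h1 : (fun p : ℝ × ℝ => ut u p.1 p.2) =ᶠ[𝓝 (t, r)] fun p => fderiv ℝ U p (1, 0) := by
        filter_upwards [hn] with p hp using eqt p hp
      rw [h1.fderiv_eq, fderiv_clm_apply (dfd _ hp) (differentiableAt_const _)]
      simp
    have ew : fderiv ℝ (fun p : ℝ × ℝ => ur u p.1 p.2) (t, r) (1, 0) =
        fderiv ℝ (fderiv ℝ U) (t, r) (1, 0) (0, 1) := by
      have h1 : (fun p : ℝ × ℝ => ur u p.1 p.2) =ᶠ[𝓝 (t, r)] fun p => fderiv ℝ U p (0, 1) := by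
        filter_upwards [hn] with p hp using eqr p hp
      rw [h1.fderiv_eq, fderiv_clm_apply (dfd _ hp) (differentiableAt_const _)]
      simp
    have sym := (hUs.contDiffAt hn).isSymmSndFDerivAt
      (by rw [minSmoothness_of_isRCLikeNormedField]; exact WithTop.coe_le_coe.2 (le_top : (2 : ℕ∞) ≤ ⊤)) (0, 1) (1, 0)
    have a1 := fderiv_apply_one_zero dv
    have a2 := fderiv_apply_zero_one dv
    have a3 := fderiv_apply_one_zero dw
    have a4 := fderiv_apply_zero_one dw
    rw [ev, sym, ← ew] at a2
    exact ⟨_, a1.differentiableAt.hasDerivAt, a2, a3, a4.differentiableAt.hasDerivAt⟩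
  · intro t r hp
    exact hPDE t ⟨hp.1.1.le, hp.1.2⟩ r hp.2
  · intro t₁ ht₁
    rcases le_or_gt t₁ (-1) with h | h
    · exact ⟨0, le_rfl, fun t r h1 h2 _ _ => absurd (h1.trans_le h2) (not_lt.2 h)⟩
    set R : Set (ℝ × ℝ) := Icc (-1) (t₁ / 2) ×ˢ Icc 0 1 with hR
    have hRsub : R ⊆ (Icc (-1 : ℝ) 0 ×ˢ Ici (0 : ℝ)) \ {((0 : ℝ), (0 : ℝ))} := by
      rintro ⟨t, r⟩ ⟨⟨h1, h2⟩, h3, h4⟩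
      dsimp only at h1 h2 h3 h4
      refine ⟨⟨⟨h1, by dsimp only; linarith⟩, h3⟩, ?_⟩
      simp only [mem_singleton_iff, Prod.mk.injEq, not_and]
      intro h; linarith
    have hRu : UniqueDiffOn ℝ R :=
      (uniqueDiffOn_Icc (by linarith)).prod (uniqueDiffOn_Icc zero_lt_one)
    have hRs : ContDiffOn ℝ 1 U R := (hreg.mono hRsub).of_le (by norm_cast)
    obtain ⟨K, hK⟩ := (isCompact_Icc.prod isCompact_Icc : IsCompact R).exists_bound_of_continuousOn
      (hRs.continuousOn_fderivWithin hRu le_rfl)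
    have hK0 : 0 ≤ K := (norm_nonneg _).trans
      (hK (-1, 0) ⟨⟨le_rfl, by dsimp only; linarith⟩, le_rfl, zero_le_one⟩)
    refine ⟨K, hK0, fun t r h1 h2 h3 h4 => ?_⟩
    have hp : (t, r) ∈ halfStrip := ⟨⟨h1, by dsimp only; linarith⟩, h3⟩
    have hpR : (t, r) ∈ R := ⟨⟨h1.le, by dsimp only; linarith⟩, h3.le, by dsimp only; linarith⟩
    have hpR0 : (t, (0 : ℝ)) ∈ R := ⟨⟨h1.le, by dsimp only; linarith⟩, le_rfl, zero_le_one⟩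
    have hnR : R ∈ 𝓝 (t, r) := prod_mem_nhds (Icc_mem_nhds h1 (by linarith))
      (Icc_mem_nhds h3 (by linarith))
    have hb := hK _ hpR
    rw [fderivWithin_of_mem_nhds hnR] at hb
    have hop : ∀ x : ℝ × ℝ, ‖x‖ ≤ 1 → |fderiv ℝ U (t, r) x| ≤ K := fun x hx => by
      have := (fderiv ℝ U (t, r)).le_opNorm x
      rw [Real.norm_eq_abs] at this
      nlinarith [norm_nonneg x, norm_nonneg (fderiv ℝ U (t, r))]
    refine ⟨?_, ?_, ?_⟩
    · have := Convex.norm_image_sub_le_of_norm_fderivWithin_le (hRs.differentiableOn one_ne_zero)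
        hK ((convex_Icc _ _).prod (convex_Icc _ _)) hpR0 hpR
      simp only [hU, hbc0 t ⟨h1.le, by linarith⟩, sub_zero, Real.norm_eq_abs] at this
      simpa [Prod.norm_def, abs_of_pos h3, h3.le] using this
    · rw [eqt _ hp]; exact hop _ (by simp [Prod.norm_def])
    · rw [eqr _ hp]; exact hop _ (by simp [Prod.norm_def])
  · refine setIntegral_nonneg measurableSet_Ioi fun r _ => ?_
    unfold eDens; positivity
  · intro t a b h1 h2 ha hab
    have ht : t ∈ Ico (-1 : ℝ) 0 := ⟨h1.le, h2⟩
    rw [← hcons t ht, intervalIntegral.integral_of_le hab]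
    have hs : Ioc a b ⊆ Ioi 0 := fun r hr => ha.trans hr.1
    calc ∫ r in Ioc a b, enDens u (t, r) = ∫ r in Ioc a b, eDens u t r * r ^ 2 := by
          refine setIntegral_congr_fun measurableSet_Ioc fun r hr => ?_
          have : r ≠ 0 := (ha.trans hr.1).ne'
          simp only [enDens, potDens, eDens, skyrme]
          field_simp
          ring
      _ ≤ _ := setIntegral_mono_set (hfin t ht)
          (Eventually.of_forall fun r => by unfold eDens; positivity)
          (LE.le.eventuallyLE hs)

lemma hasDerivAt_skyrme (x : ℝ) : HasDerivAt skyrme (2 * Real.sin x ^ 2) x := by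
  have h := (hasDerivAt_id x).sub ((Real.hasDerivAt_sin x).mul (Real.hasDerivAt_cos x))
  refine h.congr_deriv ?_
  nlinarith [Real.sin_sq_add_cos_sq x]

lemma hasDerivAt_skyrmePrim (x : ℝ) : HasDerivAt skyrmePrim (skyrme x) x := by
  have h := (((hasDerivAt_id x).pow 2).sub ((Real.hasDerivAt_sin x).pow 2)).div_const 2
  refine h.congr_deriv ?_
  simp [skyrme]; ring

/-- The derivative of `potDens` with respect to the value of `u`. -/
noncomputable def potSlope (u : ℝ → ℝ → ℝ) (p : ℝ × ℝ) : ℝ :=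
  2 * Real.sin (u p.1 p.2) * Real.cos (u p.1 p.2)
    + 2 * skyrme (u p.1 p.2) * Real.sin (u p.1 p.2) ^ 2 / p.2 ^ 2

namespace FiniteEnergyWave

variable {u : ℝ → ℝ → ℝ} {E : ℝ}

lemma contDiffOn_potDens (W : FiniteEnergyWave u E) : ContDiffOn ℝ 1 (potDens u) halfStrip := by
  have h1 := W.contDiffOn
  have h2 : ContDiffOn ℝ 1 (fun p : ℝ × ℝ => p.2) halfStrip := contDiff_snd.contDiffOn
  exact (h1.sin.pow 2).add (((h1.sub (h1.sin.mul h1.cos)).pow 2).div (contDiffOn_const.mul (h2.pow 2))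
    fun p hp => by have := (mem_Ioi.1 hp.2); positivity)

lemma contDiffOn_enDens (W : FiniteEnergyWave u E) : ContDiffOn ℝ 1 (enDens u) halfStrip :=
  have h2 : ContDiffOn ℝ 1 (fun p : ℝ × ℝ => p.2) halfStrip := contDiff_snd.contDiffOn
  ((contDiffOn_const.mul (h2.pow 2)).mul
    ((W.contDiffOn_ut.pow 2).add (W.contDiffOn_ur.pow 2))).add W.contDiffOn_potDens

lemma contDiffOn_momDens (W : FiniteEnergyWave u E) : ContDiffOn ℝ 1 (momDens u) halfStrip :=
  have h2 : ContDiffOn ℝ 1 (fun p : ℝ × ℝ => p.2) halfStrip := contDiff_snd.contDiffOn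
  ((h2.pow 2).mul W.contDiffOn_ut).mul W.contDiffOn_ur

lemma contDiffOn_uminus (W : FiniteEnergyWave u E) :
    ContDiffOn ℝ 1 (fun p : ℝ × ℝ => uminus u p.1 p.2) halfStrip :=
  W.contDiffOn_ut.sub W.contDiffOn_ur

lemma contDiffOn_outDens (W : FiniteEnergyWave u E) : ContDiffOn ℝ 1 (outDens u) halfStrip :=
  have h2 : ContDiffOn ℝ 1 (fun p : ℝ × ℝ => p.2) halfStrip := contDiff_snd.contDiffOn
  ((contDiffOn_const.mul (h2.pow 2)).mul (W.contDiffOn_uminus.pow 2)).add W.contDiffOn_potDens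

lemma contDiffOn_coneDens (W : FiniteEnergyWave u E) : ContDiffOn ℝ 1 (coneDens u) halfStrip :=
  have h2 : ContDiffOn ℝ 1 (fun p : ℝ × ℝ => p.2) halfStrip := contDiff_snd.contDiffOn
  ((contDiffOn_const.mul (h2.pow 2)).mul (W.contDiffOn_uminus.pow 2)).add
    (contDiffOn_const.mul (((h2.mul W.contDiffOn_uminus).sub W.contDiffOn).pow 2))

lemma contDiffOn_radDens (W : FiniteEnergyWave u E) : ContDiffOn ℝ 1 (radDens u) halfStrip :=
  have h2 : ContDiffOn ℝ 1 (fun p : ℝ × ℝ => p.2) halfStrip := contDiff_snd.contDiffOn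
  W.contDiffOn_outDens.sub ((h2.mul W.contDiffOn).mul W.contDiffOn_ut)

lemma contDiffOn_radFlux (W : FiniteEnergyWave u E) : ContDiffOn ℝ 1 (radFlux u) halfStrip :=
  have h2 : ContDiffOn ℝ 1 (fun p : ℝ × ℝ => p.2) halfStrip := contDiff_snd.contDiffOn
  ((((contDiffOn_const.mul (h2.pow 2)).mul (W.contDiffOn_uminus.pow 2)).add
    W.contDiffOn_potDens).sub ((h2.mul W.contDiffOn).mul W.contDiffOn_ur)).sub
    ((W.contDiffOn.pow 2).div_const 2)

lemma contDiffOn_scalDens (W : FiniteEnergyWave u E) : ContDiffOn ℝ 1 (scalDens u) halfStrip :=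
  have h1 : ContDiffOn ℝ 1 (fun p : ℝ × ℝ => p.1) halfStrip := contDiff_fst.contDiffOn
  have h2 : ContDiffOn ℝ 1 (fun p : ℝ × ℝ => p.2) halfStrip := contDiff_snd.contDiffOn
  ((h1.neg.mul W.contDiffOn_enDens).sub (h2.mul W.contDiffOn_momDens)).sub
    (((h2.pow 2).mul W.contDiffOn).mul W.contDiffOn_ut)

lemma contDiffOn_scalFlux (W : FiniteEnergyWave u E) : ContDiffOn ℝ 1 (scalFlux u) halfStrip :=
  have h1 : ContDiffOn ℝ 1 (fun p : ℝ × ℝ => p.1) halfStrip := contDiff_fst.contDiffOn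
  have h2 : ContDiffOn ℝ 1 (fun p : ℝ × ℝ => p.2) halfStrip := contDiff_snd.contDiffOn
  ((h1.neg.mul W.contDiffOn_momDens).sub (h2.mul (((contDiffOn_const.mul (h2.pow 2)).mul
    ((W.contDiffOn_ut.pow 2).add (W.contDiffOn_ur.pow 2))).sub W.contDiffOn_potDens))).sub
    (((h2.pow 2).mul W.contDiffOn).mul W.contDiffOn_ur)

lemma wave_eq (W : FiniteEnergyWave u E) {t r : ℝ} (hp : (t, r) ∈ halfStrip) :
    utt u t r = urr u t r + 2 / r * ur u t r - potSlope u (t, r) / r ^ 2 := by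
  have h := W.eqn t r hp
  have hr : r ≠ 0 := (mem_Ioi.1 hp.2).ne'
  unfold ANeq at h
  rw [Real.sin_two_mul, Real.cos_two_mul, Real.cos_sq'] at h
  simp only [potSlope, skyrme]
  field_simp at h ⊢
  linear_combination h

lemma hasDerivAt_potDens_t (W : FiniteEnergyWave u E) {t r : ℝ} (hp : (t, r) ∈ halfStrip) :
    HasDerivAt (fun s => potDens u (s, r)) (potSlope u (t, r) * ut u t r) t := by
  have h := W.hasDerivAt_t t r hp
  have h3 := (h.sin.pow 2).add ((((hasDerivAt_skyrme _).comp t h).pow 2).div_const (2 * r ^ 2))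
  refine h3.congr_deriv ?_
  simp only [potSlope, Function.comp]
  ring

lemma hasDerivAt_potDens_r (W : FiniteEnergyWave u E) {t r : ℝ} (hp : (t, r) ∈ halfStrip) :
    HasDerivAt (fun s => potDens u (t, s))
      (potSlope u (t, r) * ur u t r - skyrme (u t r) ^ 2 / r ^ 3) r := by
  have h := W.hasDerivAt_r t r hp
  have hr : r ≠ 0 := (mem_Ioi.1 hp.2).ne'
  have h3 := (h.sin.pow 2).add ((((hasDerivAt_skyrme _).comp r h).pow 2).div
    (((hasDerivAt_id r).pow 2).const_mul 2) (by simpa using hr))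
  refine h3.congr_deriv ?_
  simp only [potSlope, Function.comp, id]
  field_simp
  norm_num
  ring

lemma enDens_divergence (W : FiniteEnergyWave u E) {t r : ℝ} (hp : (t, r) ∈ halfStrip) :
    deriv (fun s => enDens u (s, r)) t - deriv (fun s => momDens u (t, s)) r = 0 := by
  obtain ⟨l, vt, vr, wt, wr⟩ := W.second t r hp
  have hr : r ≠ 0 := (mem_Ioi.1 hp.2).ne'
  have h1 := (((vt.pow 2).add (wt.pow 2)).const_mul (1 / 2 * r ^ 2)).add (W.hasDerivAt_potDens_t hp)
  have h2 := ((((hasDerivAt_id r).pow 2).mul vr).mul wr)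
  rw [show deriv (fun s => enDens u (s, r)) t = _ from h1.deriv,
    show deriv (fun s => momDens u (t, s)) r = _ from h2.deriv, W.wave_eq hp]
  simp
  field_simp
  ring

lemma radDens_divergence (W : FiniteEnergyWave u E) {t r : ℝ} (hp : (t, r) ∈ halfStrip) :
    deriv (fun s => radDens u (s, r)) t - deriv (fun s => radFlux u (t, s)) r =
      skyrme (u t r) ^ 2 / r ^ 3 + u t r * potSlope u (t, r) / r := by
  obtain ⟨l, vt, vr, wt, wr⟩ := W.second t r hp
  have hr : r ≠ 0 := (mem_Ioi.1 hp.2).ne'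
  have ht := W.hasDerivAt_t t r hp
  have hu := W.hasDerivAt_r t r hp
  have h1 := ((((vt.sub wt).pow 2).const_mul (1 / 2 * r ^ 2)).add (W.hasDerivAt_potDens_t hp)).sub
    ((ht.const_mul r).mul vt)
  have h2 := ((((((hasDerivAt_id r).pow 2).const_mul (-(1 / 2))).mul ((vr.sub wr).pow 2)).add
    (W.hasDerivAt_potDens_r hp)).sub (((hasDerivAt_id r).mul hu).mul wr)).sub ((hu.pow 2).div_const 2)
  rw [show deriv (fun s => radDens u (s, r)) t = _ from h1.deriv,
    show deriv (fun s => radFlux u (t, s)) r = _ from h2.deriv, W.wave_eq hp]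
  simp
  field_simp
  ring

lemma scalDens_divergence (W : FiniteEnergyWave u E) {t r : ℝ} (hp : (t, r) ∈ halfStrip) :
    deriv (fun s => scalDens u (s, r)) t - deriv (fun s => scalFlux u (t, s)) r =
      u t r * potSlope u (t, r) - 2 * Real.sin (u t r) ^ 2 := by
  obtain ⟨l, vt, vr, wt, wr⟩ := W.second t r hp
  have hr : r ≠ 0 := (mem_Ioi.1 hp.2).ne'
  have ht := W.hasDerivAt_t t r hp
  have hu := W.hasDerivAt_r t r hp
  have e1 := (((vt.pow 2).add (wt.pow 2)).const_mul (1 / 2 * r ^ 2)).add (W.hasDerivAt_potDens_t hp)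
  have m1 := (vt.const_mul (r ^ 2)).mul wt
  have h1 := (((hasDerivAt_id t).neg.mul e1).sub (m1.const_mul r)).sub ((ht.const_mul (r ^ 2)).mul vt)
  have m2 := ((((hasDerivAt_id r).pow 2).mul vr).mul wr)
  have h2 := ((m2.const_mul (-t)).sub ((hasDerivAt_id r).mul
    (((((hasDerivAt_id r).pow 2).const_mul (1 / 2)).mul ((vr.pow 2).add (wr.pow 2))).sub
    (W.hasDerivAt_potDens_r hp)))).sub ((((hasDerivAt_id r).pow 2).mul hu).mul wr)
  rw [show deriv (fun s => scalDens u (s, r)) t = _ from h1.deriv,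
    show deriv (fun s => scalFlux u (t, s)) r = _ from h2.deriv, W.wave_eq hp]
  simp [potDens]
  field_simp
  ring

end FiniteEnergyWave

lemma skyrme_neg (x : ℝ) : skyrme (-x) = -skyrme x := by simp [skyrme]; ring

lemma skyrme_nonneg {x : ℝ} (hx : 0 ≤ x) : 0 ≤ skyrme x := by
  have := Real.sin_le (show 0 ≤ 2 * x by linarith)
  rw [Real.sin_two_mul] at this
  unfold skyrme; linarith

lemma mul_skyrme_nonneg (x : ℝ) : 0 ≤ x * skyrme x := by
  rcases le_total 0 x with h | h
  · exact mul_nonneg h (skyrme_nonneg h)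
  · have := mul_nonneg (neg_nonneg.2 h) (skyrme_nonneg (neg_nonneg.2 h))
    rwa [skyrme_neg, neg_mul_neg] at this

lemma abs_sin_mul_cos_le (x : ℝ) : |Real.sin x * Real.cos x| ≤ 1 / 2 := by
  rw [abs_le]
  constructor <;> nlinarith [Real.sin_sq_add_cos_sq x, sq_nonneg (Real.sin x + Real.cos x),
    sq_nonneg (Real.sin x - Real.cos x)]

lemma half_mul_sin_mul_cos_add_skyrme_sq_nonneg {x k : ℝ} (hk : 0 ≤ k) (hk' : k ≤ 1 / 4) :
    0 ≤ skyrme x ^ 2 + k * (2 * (x * (Real.sin x * Real.cos x))) := by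
  wlog hx : 0 ≤ x generalizing x
  · have := this (x := -x) (by linarith)
    simpa [skyrme_neg] using this
  rcases le_total x (π / 2) with h | h
  · have h1 := Real.sin_nonneg_of_nonneg_of_le_pi hx (by linarith [Real.pi_pos])
    have h2 := Real.cos_nonneg_of_neg_pi_div_two_le_of_le (by linarith [Real.pi_pos]) h
    positivity
  · have h3 := Real.pi_gt_three
    have h1 := abs_le.1 (abs_sin_mul_cos_le x)
    have h2 : x - 1 / 2 ≤ skyrme x := by unfold skyrme; linarith
    have h4 : -(x / 2) ≤ x * (Real.sin x * Real.cos x) := by nlinarith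
    have h5 : -(x / 4) ≤ k * (2 * (x * (Real.sin x * Real.cos x))) := by nlinarith
    nlinarith

section Pointwise

variable (u : ℝ → ℝ → ℝ) (t r : ℝ)

lemma potDens_nonneg (p : ℝ × ℝ) : 0 ≤ potDens u p := by unfold potDens; positivity

lemma outDens_nonneg (p : ℝ × ℝ) : 0 ≤ outDens u p := by unfold outDens potDens; positivity

lemma momDens_sub_enDens (p : ℝ × ℝ) : momDens u p - enDens u p = -outDens u p := by
  unfold momDens enDens outDens uminus; ring

lemma radFlux_sub_radDens (p : ℝ × ℝ) : radFlux u p - radDens u p = -coneDens u p := by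
  unfold radFlux radDens coneDens outDens uminus; ring

lemma scalFlux_sub_scalDens_ge {t : ℝ} (ht : t < 0) :
    t * (3 * outDens u (t, -t) + u t (-t) ^ 2 / 2) ≤
      scalFlux u (t, -t) - scalDens u (t, -t) := by
  have e : scalFlux u (t, -t) - scalDens u (t, -t) = t * ((-t) ^ 2 * uminus u t (-t) ^ 2
      - (-t) * u t (-t) * uminus u t (-t)) := by
    simp only [scalFlux, scalDens, momDens, enDens, uminus]; ring
  rw [e]
  refine mul_le_mul_of_nonpos_left ?_ ht.le
  have := potDens_nonneg u (t, -t)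
  simp only [outDens]
  nlinarith [sq_nonneg ((-t) * uminus u t (-t) + u t (-t))]

lemma coneDens_le (p : ℝ × ℝ) : coneDens u p ≤ 3 * outDens u p + u p.1 p.2 ^ 2 := by
  have := potDens_nonneg u p
  simp only [outDens, coneDens]
  nlinarith [sq_nonneg (p.2 * uminus u p.1 p.2 + u p.1 p.2)]

lemma outDens_le (p : ℝ × ℝ) : outDens u p ≤ 2 * enDens u p := by
  have := potDens_nonneg u p
  simp only [outDens, enDens, uminus]
  nlinarith [mul_nonneg (sq_nonneg p.2) (sq_nonneg (ut u p.1 p.2 + ur u p.1 p.2))]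

lemma scalDens_ge {t r : ℝ} (hr₀ : 0 ≤ r) (hr : r ≤ -t) :
    -t / 2 * outDens u (t, r) - r * (r * u t r * ut u t r) ≤ scalDens u (t, r) := by
  have e : scalDens u (t, r) = (-t - r) * enDens u (t, r) + r * outDens u (t, r)
      - r * (r * u t r * ut u t r) := by
    simp only [scalDens, momDens, enDens, outDens, uminus]; ring
  have h1 := outDens_le u (t, r)
  have h2 := outDens_nonneg u (t, r)
  rw [e]
  nlinarith

lemma abs_mul_ut_le {s : ℝ} (hs : 0 < s) :
    |r * u t r * ut u t r| ≤ s * enDens u (t, r) + u t r ^ 2 / (2 * s) := by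
  have h : 1 / 2 * (r * ut u t r) ^ 2 ≤ enDens u (t, r) := by
    have := potDens_nonneg u (t, r)
    simp only [enDens]; nlinarith [mul_nonneg (sq_nonneg r) (sq_nonneg (ur u t r))]
  have e : s * (1 / 2 * (r * ut u t r) ^ 2) + u t r ^ 2 / (2 * s) - |r * u t r * ut u t r|
      = (s * |r * ut u t r| - |u t r|) ^ 2 / (2 * s) := by
    rw [show r * u t r * ut u t r = (r * ut u t r) * u t r by ring, abs_mul, ← sq_abs (u t r),
      ← sq_abs (r * ut u t r)]
    field_simp; ring
  have : 0 ≤ (s * |r * ut u t r| - |u t r|) ^ 2 / (2 * s) := by positivity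
  nlinarith

variable {t r}

lemma skyrme_mul_ur_le (hr : 0 < r) : skyrme (u t r) * ur u t r ≤ enDens u (t, r) := by
  have e : skyrme (u t r) ^ 2 / (2 * r ^ 2) + 1 / 2 * r ^ 2 * ur u t r ^ 2
    - skyrme (u t r) * ur u t r = (skyrme (u t r) / r - r * ur u t r) ^ 2 / 2 := by
      field_simp; ring
  have h : 0 ≤ (skyrme (u t r) / r - r * ur u t r) ^ 2 / 2 := by positivity
  simp only [enDens, potDens]
  nlinarith [sq_nonneg (Real.sin (u t r)), mul_nonneg (sq_nonneg r) (sq_nonneg (ut u t r))]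

lemma neg_skyrme_mul_uminus_le (hr : 0 < r) {s : ℝ} (hs : 0 < s) :
    -(skyrme (u t r) * uminus u t r) ≤ s * outDens u (t, r) + coneDens u (t, r) / s := by
  have e : s * (skyrme (u t r) ^ 2 / (2 * r ^ 2)) + 1 / 2 * r ^ 2 * uminus u t r ^ 2 / s
    + skyrme (u t r) * uminus u t r
      = (s * (skyrme (u t r) / r) + r * uminus u t r) ^ 2 / (2 * s) := by
      field_simp; ring
  have h : 0 ≤ (s * (skyrme (u t r) / r) + r * uminus u t r) ^ 2 / (2 * s) := by positivity
  have h1 : skyrme (u t r) ^ 2 / (2 * r ^ 2) ≤ outDens u (t, r) := by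
    simp only [outDens, potDens]
    nlinarith [sq_nonneg (Real.sin (u t r)), mul_nonneg (sq_nonneg r) (sq_nonneg (uminus u t r))]
  have h2 : 1 / 2 * r ^ 2 * uminus u t r ^ 2 / s ≤ coneDens u (t, r) / s := by
    gcongr; simp only [coneDens]; nlinarith [sq_nonneg (r * uminus u t r - u t r)]
  nlinarith

end Pointwise

namespace FiniteEnergyWave

variable {u : ℝ → ℝ → ℝ} {E : ℝ}

lemma radDens_divergence_nonneg (W : FiniteEnergyWave u E) {t r : ℝ} (hp : (t, r) ∈ halfStrip)
    (hr' : r ≤ 1 / 2) :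
    -0 ≤ deriv (fun s => radDens u (s, r)) t - deriv (fun s => radFlux u (t, s)) r := by
  rw [W.radDens_divergence hp]
  have hr : 0 < r := hp.2
  have h := half_mul_sin_mul_cos_add_skyrme_sq_nonneg (x := u t r) (sq_nonneg r) (by nlinarith)
  have h2 := mul_nonneg (mul_skyrme_nonneg (u t r)) (sq_nonneg (Real.sin (u t r)))
  have e : skyrme (u t r) ^ 2 / r ^ 3 + u t r * potSlope u (t, r) / r =
      ((skyrme (u t r) ^ 2 + r ^ 2 * (2 * (u t r * (Real.sin (u t r) * Real.cos (u t r)))))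
        + 2 * (u t r * skyrme (u t r) * Real.sin (u t r) ^ 2)) / r ^ 3 := by
    simp only [potSlope]; field_simp; ring
  rw [e]
  have : 0 ≤ (skyrme (u t r) ^ 2 + r ^ 2 * (2 * (u t r * (Real.sin (u t r) * Real.cos (u t r)))))
        + 2 * (u t r * skyrme (u t r) * Real.sin (u t r) ^ 2) := by linarith
  rw [neg_zero]
  positivity

lemma scalDens_divergence_ge (W : FiniteEnergyWave u E) {t r : ℝ} (hp : (t, r) ∈ halfStrip)  :
    -(u t r ^ 2 + 3) ≤ deriv (fun s => scalDens u (s, r)) t - deriv (fun s => scalFlux u (t, s)) r := by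
  rw [W.scalDens_divergence hp]
  have hr : 0 < r := hp.2
  have h2 := mul_nonneg (mul_skyrme_nonneg (u t r)) (sq_nonneg (Real.sin (u t r)))
  have h3 : 0 ≤ 2 * (u t r * skyrme (u t r) * Real.sin (u t r) ^ 2) / r ^ 2 := by positivity
  have e : u t r * potSlope u (t, r) = 2 * (u t r * (Real.sin (u t r) * Real.cos (u t r))) +
      2 * (u t r * skyrme (u t r) * Real.sin (u t r) ^ 2) / r ^ 2 := by
    simp only [potSlope]; field_simp
  have h4 := abs_le.1 (abs_sin_mul_cos_le (u t r))
  have h5 : (Real.sin (u t r) * Real.cos (u t r)) ^ 2 ≤ 1 := by nlinarith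
  rw [e]
  nlinarith [Real.sin_sq_le_one (u t r), sq_nonneg (u t r + Real.sin (u t r) * Real.cos (u t r))]

end FiniteEnergyWave

lemma skyrmePrim_le (x : ℝ) : skyrmePrim x ≤ x ^ 2 / 2 := by
  unfold skyrmePrim; nlinarith [sq_nonneg (Real.sin x)]

lemma skyrmePrim_neg (x : ℝ) : skyrmePrim (-x) = skyrmePrim x := by simp [skyrmePrim]

lemma monotoneOn_skyrmePrim : MonotoneOn skyrmePrim (Ici 0) := by
  refine monotoneOn_of_deriv_nonneg (convex_Ici 0)
    (fun x _ => (hasDerivAt_skyrmePrim x).continuousAt.continuousWithinAt)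
    (fun x _ => (hasDerivAt_skyrmePrim x).differentiableAt.differentiableWithinAt) fun x hx => ?_
  rw [(hasDerivAt_skyrmePrim x).deriv]
  exact skyrme_nonneg (interior_subset hx)

lemma skyrmePrim_pos {x : ℝ} (hx : 0 < x) : 0 < skyrmePrim x := by
  have h1 : |Real.sin x| < |x| := by
    rw [abs_of_pos hx]
    refine abs_lt.2 ⟨?_, Real.sin_lt hx⟩
    rcases le_or_gt x 1 with h | h
    · have := Real.sin_pos_of_pos_of_le_one hx h; linarith
    · have := Real.neg_one_le_sin x; linarith
  have := sq_lt_sq.2 h1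
  unfold skyrmePrim; linarith

lemma abs_lt_of_skyrmePrim_lt {x y : ℝ} (hy : 0 < y) (h : skyrmePrim x < skyrmePrim y) :
    |x| < y := by
  by_contra! hc
  have h1 := monotoneOn_skyrmePrim (mem_Ici.2 hy.le) (mem_Ici.2 (abs_nonneg x)) hc
  rcases abs_choice x with h2 | h2 <;> rw [h2] at h1
  · linarith
  · rw [skyrmePrim_neg] at h1; linarith

lemma continuousOn_slice {F : ℝ × ℝ → ℝ} (hF : ContinuousOn F halfStrip) {t a b : ℝ}
    (ht : -1 < t) (ht' : t < 0) (ha : 0 < a) : ContinuousOn (fun r => F (t, r)) (Icc a b) :=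
  hF.comp (by fun_prop) fun r hr => ⟨⟨ht, ht'⟩, mem_Ioi.2 (ha.trans_le hr.1)⟩

lemma continuousOn_cone {F : ℝ × ℝ → ℝ} (hF : ContinuousOn F halfStrip) {t₀ t₁ c : ℝ}
    (ht₀ : -1 < t₀) (ht₁ : t₁ < 0) (hc : t₁ < c) :
    ContinuousOn (fun t => F (t, c - t)) (Icc t₀ t₁) :=
  hF.comp (by fun_prop) fun t ht => ⟨⟨ht₀.trans_le ht.1, ht.2.trans_lt ht₁⟩,
    mem_Ioi.2 (by dsimp only; linarith [ht.2])⟩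

namespace FiniteEnergyWave

variable {u : ℝ → ℝ → ℝ} {E : ℝ}

lemma skyrmePrim_le_slice (W : FiniteEnergyWave u E) {t a b : ℝ} (ht : -1 < t) (ht' : t < 0)
    (ha : 0 < a) (hab : a ≤ b) :
    skyrmePrim (u t b) ≤ skyrmePrim (u t a) + ∫ r in a..b, enDens u (t, r) := by
  have hp : ∀ r ∈ Icc a b, (t, r) ∈ halfStrip := fun r hr =>
    ⟨⟨ht, ht'⟩, mem_Ioi.2 (ha.trans_le hr.1)⟩
  have cs : Continuous skyrme := by unfold skyrme; fun_prop
  have c1 : ContinuousOn (fun r => skyrme (u t r) * ur u t r) (Icc a b) :=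
    continuousOn_slice ((cs.comp_continuousOn W.contDiffOn.continuousOn).mul
      W.contDiffOn_ur.continuousOn) ht ht' ha
  have i1 := c1.intervalIntegrable_of_Icc (μ := volume) hab
  have h1 := intervalIntegral.integral_eq_sub_of_hasDerivAt
    (f := fun r => skyrmePrim (u t r)) (f' := fun r => skyrme (u t r) * ur u t r)
    (fun r hr => by
      rw [uIcc_of_le hab] at hr
      exact (hasDerivAt_skyrmePrim _).comp r (W.hasDerivAt_r t r (hp r hr))) i1
  have h2 := intervalIntegral.integral_mono_on hab i1
    ((continuousOn_slice W.contDiffOn_enDens.continuousOn ht ht' ha).intervalIntegrable_of_Icc hab)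
    fun r hr => skyrme_mul_ur_le u (hp r hr).2
  linarith

lemma skyrmePrim_le_energy (W : FiniteEnergyWave u E) {t r : ℝ} (ht : -1 < t) (ht' : t < 0)
    (hr : 0 < r) : skyrmePrim (u t r) ≤ E := by
  obtain ⟨K, hK, hax⟩ := W.axis t ht'
  have hlim : Tendsto (fun a : ℝ => (K * a) ^ 2 / 2 + E) (𝓝[>] 0) (𝓝 E) := by
    have : Continuous fun a : ℝ => (K * a) ^ 2 / 2 + E := by fun_prop
    simpa using (this.tendsto 0).mono_left nhdsWithin_le_nhds
  refine ge_of_tendsto hlim ?_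
  filter_upwards [Ioo_mem_nhdsGT (lt_min hr one_half_pos)] with a ha
  have h1 := W.skyrmePrim_le_slice ht ht' ha.1 (ha.2.le.trans (min_le_left _ _))
  have h2 := W.energy t a r ht ht' ha.1 (ha.2.le.trans (min_le_left _ _))
  have h3 := skyrmePrim_le (u t a)
  have h4 := sq_le_sq.2 (((hax t a ht le_rfl ha.1 (ha.2.le.trans (min_le_right _ _))).1).trans
    (le_abs_self _))
  linarith

lemma sq_le (W : FiniteEnergyWave u E) {t r : ℝ} (ht : -1 < t) (ht' : t < 0)
    (hr : 0 < r) : u t r ^ 2 ≤ 2 * E + 1 := by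
  have h1 := W.skyrmePrim_le_energy ht ht' hr
  unfold skyrmePrim at h1
  linarith [Real.sin_sq_le_one (u t r)]

lemma intervalIntegrable_mul_ut (W : FiniteEnergyWave u E) {t a b : ℝ} (ht : -1 < t) (ht' : t < 0)
    (ha : 0 < a) (hab : a ≤ b) :
    IntervalIntegrable (fun r => r * u t r * ut u t r) volume a b :=
  (continuousOn_slice (F := fun p => p.2 * u p.1 p.2 * ut u p.1 p.2)
    ((continuousOn_snd.mul W.contDiffOn.continuousOn).mul W.contDiffOn_ut.continuousOn)
    ht ht' ha).intervalIntegrable_of_Icc hab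

lemma integral_abs_mul_ut_le (W : FiniteEnergyWave u E) {t a b s : ℝ} (ht : -1 < t) (ht' : t < 0)
    (ha : 0 < a) (hab : a ≤ b) (hs : 0 < s) :
    ∫ r in a..b, |r * u t r * ut u t r| ≤ s * E + (2 * E + 1) / (2 * s) * (b - a) := by
  have i1 := (W.intervalIntegrable_mul_ut ht ht' ha hab).abs
  have i2 : IntervalIntegrable (fun r => enDens u (t, r)) volume a b :=
    (continuousOn_slice W.contDiffOn_enDens.continuousOn ht ht' ha).intervalIntegrable_of_Icc hab
  have h := intervalIntegral.integral_mono_on hab i1 ((i2.const_mul s).add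
    (intervalIntegrable_const (c := (2 * E + 1) / (2 * s)))) fun r hr => (abs_mul_ut_le u t r hs).trans
      (add_le_add le_rfl (by gcongr; exact W.sq_le ht ht' (ha.trans_le hr.1)))
  rw [intervalIntegral.integral_add (i2.const_mul s) intervalIntegrable_const,
    intervalIntegral.integral_const_mul, intervalIntegral.integral_const] at h
  have h2 := mul_le_mul_of_nonneg_left (W.energy t a b ht ht' ha hab) hs.le
  simp only [smul_eq_mul] at h
  linarith

lemma skyrmePrim_le_cone (W : FiniteEnergyWave u E) {t₀ t₁ c s : ℝ} (ht₀ : -1 < t₀) (ht : t₀ ≤ t₁)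
    (ht₁ : t₁ < 0) (hc : t₁ < c) (hs : 0 < s) :
    skyrmePrim (u t₀ (c - t₀)) ≤ skyrmePrim (u t₁ (c - t₁)) +
      s * (∫ t in t₀..t₁, outDens u (t, c - t)) + (∫ t in t₀..t₁, coneDens u (t, c - t)) / s := by
  have hp : ∀ t ∈ Icc t₀ t₁, (t, c - t) ∈ halfStrip := fun t ht =>
    ⟨⟨ht₀.trans_le ht.1, ht.2.trans_lt ht₁⟩, mem_Ioi.2 (by dsimp only; linarith [ht.2])⟩
  have cs : Continuous skyrme := by unfold skyrme; fun_prop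
  have c1 : ContinuousOn (fun t => skyrme (u t (c - t)) * uminus u t (c - t)) (Icc t₀ t₁) :=
    continuousOn_cone ((cs.comp_continuousOn W.contDiffOn.continuousOn).mul
      W.contDiffOn_uminus.continuousOn) ht₀ ht₁ hc
  have i1 := c1.intervalIntegrable_of_Icc (μ := volume) ht
  have i2 : IntervalIntegrable (fun t => outDens u (t, c - t)) volume t₀ t₁ :=
    (continuousOn_cone W.contDiffOn_outDens.continuousOn ht₀ ht₁ hc).intervalIntegrable_of_Icc ht
  have i3 : IntervalIntegrable (fun t => coneDens u (t, c - t)) volume t₀ t₁ :=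
    (continuousOn_cone W.contDiffOn_coneDens.continuousOn ht₀ ht₁ hc).intervalIntegrable_of_Icc ht
  have h1 := intervalIntegral.integral_eq_sub_of_hasDerivAt
    (f := fun t => skyrmePrim (u t (c - t)))
    (f' := fun t => skyrme (u t (c - t)) * uminus u t (c - t))
    (fun t ht' => by
      rw [uIcc_of_le ht] at ht'
      have hd : DifferentiableAt ℝ (fun p : ℝ × ℝ => u p.1 p.2) (t, c - t) :=
        (W.contDiffOn.contDiffAt (isOpen_halfStrip.mem_nhds (hp t ht'))).differentiableAt one_ne_zero
      have h2 : HasDerivAt (fun s => ((s, c - s) : ℝ × ℝ)) (1, -1) t :=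
        (hasDerivAt_id t).prodMk ((hasDerivAt_id t).const_sub c)
      have h3 := hd.hasFDerivAt.comp_hasDerivAt t h2
      have h4 : fderiv ℝ (fun p : ℝ × ℝ => u p.1 p.2) (t, c - t) (1, -1) = uminus u t (c - t) := by
        rw [show ((1 : ℝ), (-1 : ℝ)) = (1, 0) - (0, 1) by simp, map_sub,
          (fderiv_apply_one_zero hd).unique (W.hasDerivAt_t _ _ (hp t ht')),
          (fderiv_apply_zero_one hd).unique (W.hasDerivAt_r _ _ (hp t ht'))]
        rfl
      rw [h4] at h3
      exact (hasDerivAt_skyrmePrim _).comp t h3) i1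
  have h2 := intervalIntegral.integral_mono_on ht i1.neg
    ((i2.const_mul s).add (i3.div_const s)) fun t ht' => neg_skyrme_mul_uminus_le u (hp t ht').2 hs
  rw [intervalIntegral.integral_add (i2.const_mul s) (i3.div_const s),
    intervalIntegral.integral_const_mul, intervalIntegral.integral_div] at h2
  simp only [Pi.neg_apply, intervalIntegral.integral_neg] at h2
  linarith

end FiniteEnergyWave

namespace FiniteEnergyWave

variable {u : ℝ → ℝ → ℝ} {E : ℝ}

lemma energy_balance (W : FiniteEnergyWave u E) {t₀ t₁ a₀ a₁ b₀ b₁ : ℝ} (ht₀ : -1 < t₀)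
    (ht : t₀ ≤ t₁) (ht₁ : t₁ < 0) (ha : ∀ t ∈ Icc t₀ t₁, 0 < a₀ + a₁ * t)
    (hab : ∀ t ∈ Icc t₀ t₁, a₀ + a₁ * t ≤ b₀ + b₁ * t) :
    (∫ t in t₀..t₁, (momDens u (t, b₀ + b₁ * t) + b₁ * enDens u (t, b₀ + b₁ * t))) -
      (∫ t in t₀..t₁, (momDens u (t, a₀ + a₁ * t) + a₁ * enDens u (t, a₀ + a₁ * t))) =
    (∫ r in (a₀ + a₁ * t₁)..(b₀ + b₁ * t₁), enDens u (t₁, r)) -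
      ∫ r in (a₀ + a₁ * t₀)..(b₀ + b₁ * t₀), enDens u (t₀, r) := by
  have hw : ∀ t ∈ Icc t₀ t₁, b₀ + b₁ * t - (a₀ + a₁ * t) ≤ |b₀ - a₀| + |b₁ - a₁| := by
    intro t ht'
    have h1 := le_abs_self (b₀ - a₀)
    have h2 : (b₁ - a₁) * t ≤ |b₁ - a₁| := by
      refine (le_abs_self _).trans ?_
      rw [abs_mul]
      refine mul_le_of_le_one_right (abs_nonneg _) (abs_le.2 ⟨?_, ?_⟩) <;> linarith [ht'.1, ht'.2]
    linarith
  have hS : ∀ t ∈ Icc t₀ t₁, ∀ r ∈ Icc (a₀ + a₁ * t) (b₀ + b₁ * t), (t, r) ∈ halfStrip :=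
    fun t ht' r hr => ⟨⟨ht₀.trans_le ht'.1, ht'.2.trans_lt ht₁⟩,
      mem_Ioi.2 ((ha t ht').trans_le hr.1)⟩
  have h1 := trapezoid_lower_bound W.contDiffOn_enDens W.contDiffOn_momDens ht₀ ht ht₁ le_rfl ha hab
    hw fun t ht' r hr => by rw [W.enDens_divergence (hS t ht' r hr), neg_zero]
  have h2 := trapezoid_lower_bound W.contDiffOn_enDens.neg W.contDiffOn_momDens.neg ht₀ ht ht₁
    le_rfl ha hab hw fun t ht' r hr => by
      have := W.enDens_divergence (hS t ht' r hr)
      simp only [deriv.fun_neg]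
      linarith
  have e : ∀ x y z : ℝ, -x + y * -z = -(x + y * z) := fun x y z => by ring
  simp only [e, intervalIntegral.integral_neg] at h2
  linarith

lemma momDens_abs_le {K t r : ℝ} (hK : 0 ≤ K) (h : |ut u t r| ≤ K ∧ |ur u t r| ≤ K) :
    |momDens u (t, r)| ≤ r ^ 2 * K ^ 2 := by
  simp only [momDens, abs_mul, abs_pow, sq_abs, mul_assoc]
  rw [sq K]
  exact mul_le_mul_of_nonneg_left (mul_le_mul h.1 h.2 (abs_nonneg _) hK) (sq_nonneg _)

lemma integrable_cone {F : ℝ × ℝ → ℝ} (hF : ContDiffOn ℝ 1 F halfStrip) {t₀ t₁ c : ℝ}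
    (ht₀ : -1 < t₀) (ht : t₀ ≤ t₁) (ht₁ : t₁ < 0) (hc : t₁ < c) :
    IntervalIntegrable (fun t => F (t, c - t)) volume t₀ t₁ :=
  (continuousOn_cone hF.continuousOn ht₀ ht₁ hc).intervalIntegrable_of_Icc ht

lemma integrable_slice {F : ℝ × ℝ → ℝ} (hF : ContDiffOn ℝ 1 F halfStrip) {t a b : ℝ}
    (ht : -1 < t) (ht' : t < 0) (ha : 0 < a) (hab : a ≤ b) :
    IntervalIntegrable (fun r => F (t, r)) volume a b :=
  (continuousOn_slice hF.continuousOn ht ht' ha).intervalIntegrable_of_Icc hab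

lemma cone_flux_le (W : FiniteEnergyWave u E) {t₀ t₁ : ℝ} (ht₀ : -1 < t₀) (ht : t₀ ≤ t₁)
    (ht₁ : t₁ < 0) : ∫ t in t₀..t₁, outDens u (t, 0 - t) ≤ E := by
  obtain ⟨K, hK, hax⟩ := W.axis t₁ ht₁
  have hlim : Tendsto (fun a : ℝ => E + a ^ 2 * K ^ 2 * (t₁ - t₀)) (𝓝[>] 0) (𝓝 E) := by
    have : Continuous fun a : ℝ => E + a ^ 2 * K ^ 2 * (t₁ - t₀) := by fun_prop
    simpa using (this.tendsto 0).mono_left nhdsWithin_le_nhds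
  refine ge_of_tendsto hlim ?_
  filter_upwards [Ioo_mem_nhdsGT (lt_min (neg_pos.2 ht₁) one_half_pos)] with a ha
  have ha1 : a ≤ -t₁ := ha.2.le.trans (min_le_left _ _)
  have h := W.energy_balance (a₀ := a) (a₁ := 0) (b₀ := 0) (b₁ := -1) ht₀ ht ht₁
    (fun t _ => by simpa using ha.1) (fun t ht' => by linarith [ht'.2])
  simp only [zero_mul, add_zero, neg_one_mul, ← sub_eq_add_neg, momDens_sub_enDens,
    intervalIntegral.integral_neg] at h
  have h2 : |∫ t in t₀..t₁, momDens u (t, a)| ≤ a ^ 2 * K ^ 2 * |t₁ - t₀| := by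
    refine intervalIntegral.norm_integral_le_of_norm_le_const (E := ℝ) fun t ht' => ?_
    rw [uIoc_of_le ht] at ht'
    exact momDens_abs_le hK
      (hax t a (ht₀.trans ht'.1) ht'.2 ha.1 (ha.2.le.trans (min_le_right _ _))).2
  rw [abs_of_nonneg (sub_nonneg.2 ht)] at h2
  have h3 := W.energy t₀ a (0 - t₀) ht₀ (by linarith) ha.1 (by linarith)
  have h4 : 0 ≤ ∫ r in a..(0 - t₁), enDens u (t₁, r) :=
    intervalIntegral.integral_nonneg (by linarith) fun r _ => enDens_nonneg u _
  linarith [neg_abs_le (∫ t in t₀..t₁, momDens u (t, a))]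

lemma exists_cone_flux_le (W : FiniteEnergyWave u E) {κ : ℝ} (hκ : 0 < κ) :
    ∃ T, -(1 / 2) ≤ T ∧ T < 0 ∧ ∀ t₀ t₁, T ≤ t₀ → t₀ ≤ t₁ → t₁ < 0 →
      ∫ t in t₀..t₁, outDens u (t, 0 - t) ≤ κ := by
  set f : ℝ → ℝ := fun s => ∫ t in (-(1 / 2))..s, outDens u (t, 0 - t) with hf
  set S : Set ℝ := f '' Ico (-(1 / 2)) 0 with hS
  have hb : BddAbove S := ⟨E, by
    rintro _ ⟨s, hs, rfl⟩
    exact W.cone_flux_le (by norm_num) hs.1 hs.2⟩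
  have hne : S.Nonempty := ⟨_, -(1 / 2), by constructor <;> norm_num, rfl⟩
  obtain ⟨_, ⟨T, hT, rfl⟩, hlt⟩ := exists_lt_of_lt_csSup hne (sub_lt_self (sSup S) hκ)
  refine ⟨T, hT.1, hT.2, fun t₀ t₁ h0 h h1 => ?_⟩
  have i1 : ∀ a b, -(1 / 2) ≤ a → a ≤ b → b < 0 →
      IntervalIntegrable (fun t => outDens u (t, 0 - t)) volume a b := fun a b ha hab hb =>
    integrable_cone W.contDiffOn_outDens (by linarith) hab hb hb
  have e1 : f T + (∫ t in T..t₀, outDens u (t, 0 - t)) + (∫ t in t₀..t₁, outDens u (t, 0 - t))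
      = f t₁ := by
    simp only [hf]
    rw [intervalIntegral.integral_add_adjacent_intervals (i1 _ _ le_rfl hT.1 hT.2)
      (i1 _ _ hT.1 h0 (by linarith)), intervalIntegral.integral_add_adjacent_intervals
      (i1 _ _ le_rfl (hT.1.trans h0) (by linarith)) (i1 _ _ (hT.1.trans h0) h h1)]
  have h2 : f t₁ ≤ sSup S := le_csSup hb ⟨t₁, ⟨(hT.1.trans h0).trans h, h1⟩, rfl⟩
  have h3 : 0 ≤ ∫ t in T..t₀, outDens u (t, 0 - t) :=
    intervalIntegral.integral_nonneg h0 fun t _ => outDens_nonneg u _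
  linarith

lemma strip_flux_le (W : FiniteEnergyWave u E) {t₀ t₁ η : ℝ} (ht₀ : -1 < t₀) (ht : t₀ ≤ t₁)
    (hη : 0 ≤ η) (ht₁ : t₁ < -η) :
    ∫ t in t₀..t₁, outDens u (t, -η - t) ≤ E + ∫ t in t₀..t₁, outDens u (t, 0 - t) := by
  have h := W.energy_balance (a₀ := -η) (a₁ := -1) (b₀ := 0) (b₁ := -1) ht₀ ht (by linarith)
    (fun t ht' => by linarith [ht'.2]) (fun t ht' => by linarith [ht'.2])
  simp only [neg_one_mul, ← sub_eq_add_neg, momDens_sub_enDens,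
    intervalIntegral.integral_neg] at h
  have h3 := W.energy t₁ (-η - t₁) (0 - t₁) (by linarith) (by linarith) (by linarith) (by linarith)
  have h4 : 0 ≤ ∫ r in (-η - t₀)..(0 - t₀), enDens u (t₀, r) :=
    intervalIntegral.integral_nonneg (by linarith) fun r _ => enDens_nonneg u _
  linarith

lemma outer_strip_energy_le (W : FiniteEnergyWave u E) {t₀ t₁ δ : ℝ} (ht₀ : -1 < t₀) (ht : t₀ ≤ t₁)
    (hδ : 0 ≤ δ) (ht₁ : t₁ < 0) :
    ∫ r in (0 - t₁)..(δ - t₁), enDens u (t₁, r) ≤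
      (∫ r in (0 - t₀)..(δ - t₀), enDens u (t₀, r)) + ∫ t in t₀..t₁, outDens u (t, 0 - t) := by
  have h := W.energy_balance (a₀ := 0) (a₁ := -1) (b₀ := δ) (b₁ := -1) ht₀ ht (by linarith)
    (fun t ht' => by linarith [ht'.2]) (fun t ht' => by linarith [ht'.2])
  simp only [neg_one_mul, ← sub_eq_add_neg, momDens_sub_enDens,
    intervalIntegral.integral_neg] at h
  have h4 : 0 ≤ ∫ t in t₀..t₁, outDens u (t, δ - t) :=
    intervalIntegral.integral_nonneg ht fun t _ => outDens_nonneg u _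
  linarith

lemma strip_cone_le (W : FiniteEnergyWave u E) {t₀ t₁ η : ℝ} (ht₀ : -(1 / 2) ≤ t₀) (ht : t₀ ≤ t₁)
    (hη : 0 ≤ η) (ht₁ : t₁ < -η) :
    ∫ t in t₀..t₁, coneDens u (t, -η - t) ≤ (∫ t in t₀..t₁, coneDens u (t, 0 - t)) +
      (∫ r in (-η - t₁)..(0 - t₁), radDens u (t₁, r)) -
      ∫ r in (-η - t₀)..(0 - t₀), radDens u (t₀, r) := by
  have h := trapezoid_lower_bound W.contDiffOn_radDens W.contDiffOn_radFlux (a₀ := -η) (a₁ := -1)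
    (b₀ := 0) (b₁ := -1) (w := η) (by linarith) ht (by linarith) le_rfl
    (fun t ht' => by linarith [ht'.2]) (fun t ht' => by linarith [ht'.2])
    (fun t ht' => by linarith [ht'.2]) fun t ht' r hr =>
      W.radDens_divergence_nonneg ⟨⟨by dsimp only; linarith [ht'.1],
        by dsimp only; linarith [ht'.2]⟩, mem_Ioi.2 (by dsimp only; linarith [ht'.2, hr.1])⟩
        (by linarith [ht'.1, hr.2])
  simp only [neg_one_mul, ← sub_eq_add_neg, radFlux_sub_radDens,
    intervalIntegral.integral_neg] at h
  linarith

lemma scalFlux_le {K t r : ℝ} (ht : -1 < t) (ht' : t < 0) (hr : 0 < r) (hr' : r ≤ 1 / 2)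
    (h : |u t r| ≤ K * r ∧ |ut u t r| ≤ K ∧ |ur u t r| ≤ K) (hK : 0 ≤ K) :
    scalFlux u (t, r) ≤ 3 * K ^ 2 * r := by
  obtain ⟨h1, h2, h3⟩ := h
  have hm := (abs_le.1 (momDens_abs_le hK ⟨h2, h3⟩)).2
  have hs : Real.sin (u t r) ^ 2 ≤ (K * r) ^ 2 :=
    sq_le_sq.2 ((Real.abs_sin_le_abs.trans h1).trans (le_abs_self _))
  have ha : skyrme (u t r) ^ 2 ≤ (2 * (K * r)) ^ 2 := by
    refine sq_le_sq.2 (le_trans ?_ (le_abs_self _))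
    unfold skyrme
    have h5 : |Real.sin (u t r) * Real.cos (u t r)| ≤ |u t r| * 1 := by
      rw [abs_mul]
      exact mul_le_mul Real.abs_sin_le_abs (Real.abs_cos_le_one _) (abs_nonneg _) (abs_nonneg _)
    have := abs_sub (u t r) (Real.sin (u t r) * Real.cos (u t r))
    linarith
  have hp : potDens u (t, r) ≤ (K * r) ^ 2 + 2 * K ^ 2 := by
    have : skyrme (u t r) ^ 2 / (2 * r ^ 2) ≤ 2 * K ^ 2 := by
      rw [div_le_iff₀ (by positivity)]; nlinarith
    simp only [potDens]; linarith
  have hq : -(u t r * ur u t r) ≤ K * r * K := by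
    refine (neg_le_abs _).trans ?_
    rw [abs_mul]
    exact mul_le_mul h1 h3 (abs_nonneg _) (by positivity)
  have e : scalFlux u (t, r) = -t * momDens u (t, r) + r * potDens u (t, r)
      + r ^ 2 * -(u t r * ur u t r) - 1 / 2 * r ^ 3 * (ut u t r ^ 2 + ur u t r ^ 2) := by
    simp only [scalFlux]; ring
  have k1 : -t * momDens u (t, r) ≤ r ^ 2 * K ^ 2 := by
    have : 0 ≤ r ^ 2 * K ^ 2 := by positivity
    nlinarith
  have k2 := mul_le_mul_of_nonneg_left hp hr.le
  have k3 := mul_le_mul_of_nonneg_left hq (sq_nonneg r)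
  have k4 : 0 ≤ 1 / 2 * r ^ 3 * (ut u t r ^ 2 + ur u t r ^ 2) := by positivity
  have k5 : r ^ 2 * K ^ 2 ≤ 1 / 2 * (r * K ^ 2) := by
    have : 0 ≤ r * K ^ 2 := by positivity
    nlinarith
  have k6 : r ^ 3 * K ^ 2 ≤ 1 / 4 * (r * K ^ 2) := by
    have : 0 ≤ r * K ^ 2 := by positivity
    have : r ^ 2 ≤ 1 / 4 := by nlinarith
    nlinarith
  rw [e]
  nlinarith

end FiniteEnergyWave

namespace FiniteEnergyWave

variable {u : ℝ → ℝ → ℝ} {E : ℝ}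

lemma scal_cone_ge (W : FiniteEnergyWave u E) {t₀ t₁ κ : ℝ} (ht₀ : -1 < t₀)
    (ht : t₀ ≤ t₁) (ht₁ : t₁ < 0) (hκ : ∫ t in t₀..t₁, outDens u (t, 0 - t) ≤ κ) :
    t₀ * (3 * κ + (2 * E + 1) / 2 * -t₀) ≤
      ∫ t in t₀..t₁, (scalFlux u (t, 0 - t) - scalDens u (t, 0 - t)) := by
  have i1 := integrable_cone W.contDiffOn_outDens ht₀ ht ht₁ ht₁
  have i2 := (integrable_cone W.contDiffOn_scalFlux ht₀ ht ht₁ ht₁).sub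
    (integrable_cone W.contDiffOn_scalDens ht₀ ht ht₁ ht₁)
  have h := intervalIntegral.integral_mono_on ht (((i1.const_mul 3).add
    (intervalIntegrable_const (c := (2 * E + 1) / 2))).const_mul t₀) i2 fun t ht' => by
      have h0 : t < 0 := ht'.2.trans_lt ht₁
      have h1 := W.sq_le (ht₀.trans_le ht'.1) h0 (neg_pos.2 h0)
      have h2 := scalFlux_sub_scalDens_ge u h0
      have h3 := outDens_nonneg u (t, -t)
      simp only [zero_sub]
      refine le_trans ?_ h2
      nlinarith [ht'.1, sq_nonneg (u t (-t))]
  rw [intervalIntegral.integral_const_mul, intervalIntegral.integral_add (i1.const_mul 3)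
    intervalIntegrable_const, intervalIntegral.integral_const_mul,
    intervalIntegral.integral_const] at h
  refine le_trans ?_ h
  have hE := W.energy_nonneg
  refine mul_le_mul_of_nonpos_left ?_ (by linarith)
  simp only [smul_eq_mul]
  nlinarith

lemma scalDens_integral_le (W : FiniteEnergyWave u E) {t a : ℝ} (ht : -1 < t) (ht' : t < 0)
    (ha : 0 < a) (hat : a ≤ 0 - t) :
    ∫ r in a..(0 - t), scalDens u (t, r) ≤ -t * (4 * E + 1) := by
  have i1 := integrable_slice W.contDiffOn_enDens ht ht' ha hat
  have i2 := (W.intervalIntegrable_mul_ut ht ht' ha hat).abs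
  have h := intervalIntegral.integral_mono_on hat
    (integrable_slice W.contDiffOn_scalDens ht ht' ha hat)
    (((i1.const_mul 2).add i2).const_mul (-t)) fun r hr => by
      have hr0 : 0 < r := ha.trans_le hr.1
      have e : scalDens u (t, r) = -t * enDens u (t, r) + r * (-momDens u (t, r))
          + r * -(r * u t r * ut u t r) := by
        simp only [scalDens]; ring
      have h1 : -momDens u (t, r) ≤ enDens u (t, r) := by
        have := potDens_nonneg u (t, r)
        simp only [momDens, enDens]
        nlinarith [mul_nonneg (sq_nonneg r) (sq_nonneg (ut u t r + ur u t r))]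
      have h2 := neg_le_abs (r * u t r * ut u t r)
      have h3 := enDens_nonneg u (t, r)
      have h4 := abs_nonneg (r * u t r * ut u t r)
      have h5 := hr.2
      rw [e]
      nlinarith
  rw [intervalIntegral.integral_const_mul, intervalIntegral.integral_add (i1.const_mul 2) i2,
    intervalIntegral.integral_const_mul] at h
  have h1 := W.energy t a (0 - t) ht ht' ha hat
  have h2 := W.integral_abs_mul_ut_le ht ht' ha hat one_pos
  have hE := W.energy_nonneg
  refine h.trans (mul_le_mul_of_nonneg_left ?_ (by linarith))
  nlinarith

lemma scalDens_integral_ge (W : FiniteEnergyWave u E) {t a s : ℝ} (ht : -1 < t) (ht' : t < 0)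
    (ha : 0 < a) (hat : a ≤ 0 - t) (hs : 0 < s) :
    -t / 2 * (∫ r in a..(0 - t), outDens u (t, r)) - -t * (s * E + (2 * E + 1) / (2 * s) * -t) ≤
      ∫ r in a..(0 - t), scalDens u (t, r) := by
  have i1 := integrable_slice W.contDiffOn_outDens ht ht' ha hat
  have i2 := (W.intervalIntegrable_mul_ut ht ht' ha hat).abs
  have h := intervalIntegral.integral_mono_on hat ((i1.const_mul (-t / 2)).sub (i2.const_mul (-t)))
    (integrable_slice W.contDiffOn_scalDens ht ht' ha hat) fun r hr => by
      have hr0 : 0 < r := ha.trans_le hr.1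
      refine le_trans ?_ (scalDens_ge u hr0.le (by linarith [hr.2]))
      have h2 := le_abs_self (r * u t r * ut u t r)
      have h4 := abs_nonneg (r * u t r * ut u t r)
      have h5 := hr.2
      nlinarith
  rw [intervalIntegral.integral_sub (i1.const_mul _) (i2.const_mul _),
    intervalIntegral.integral_const_mul, intervalIntegral.integral_const_mul] at h
  have h2 := W.integral_abs_mul_ut_le ht ht' ha hat hs
  have hE := W.energy_nonneg
  have h3 : (2 * E + 1) / (2 * s) * (0 - t - a) ≤ (2 * E + 1) / (2 * s) * -t := by
    gcongr; linarith
  have h4 := mul_le_mul_of_nonneg_left (h2.trans (add_le_add_right h3 _)) (neg_nonneg.2 ht'.le)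
  linarith

lemma scal_estimate (W : FiniteEnergyWave u E) {t₀ t₁ κ a K s : ℝ} (ht₀ : -1 < t₀)
    (ht : t₀ ≤ t₁) (ht₁ : t₁ < 0) (hκ : ∫ t in t₀..t₁, outDens u (t, 0 - t) ≤ κ)
    (ha : 0 < a) (hat : a ≤ 0 - t₁) (ha' : a ≤ 1 / 2) (hK : 0 ≤ K) (hs : 0 < s)
    (hax : ∀ t r, -1 < t → t ≤ t₁ → 0 < r → r ≤ 1 / 2 →
      |u t r| ≤ K * r ∧ |ut u t r| ≤ K ∧ |ur u t r| ≤ K) :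
    -t₀ / 2 * (∫ r in a..(0 - t₀), outDens u (t₀, r)) ≤
      -t₀ * (s * E + (2 * E + 1) / (2 * s) * -t₀) + -t₁ * (4 * E + 1) +
      -t₀ * (3 * κ + (2 * E + 1) / 2 * -t₀) + (2 * E + 4) * t₀ ^ 2 + 3 * K ^ 2 * a := by
  have h := trapezoid_lower_bound W.contDiffOn_scalDens W.contDiffOn_scalFlux (a₀ := a) (a₁ := 0)
    (b₀ := 0) (b₁ := -1) (w := -t₀) (c := 2 * E + 4) ht₀ ht (by linarith)
    (by linarith [W.energy_nonneg])
    (fun t _ => by simpa using ha) (fun t ht' => by linarith [ht'.2])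
    (fun t ht' => by linarith [ht'.1]) fun t ht' r hr => by
      have hp : 0 < r := by linarith [hr.1]
      have h1 : -1 < t := ht₀.trans_le ht'.1
      have h2 : t < 0 := ht'.2.trans_lt ht₁
      refine le_trans ?_ (W.scalDens_divergence_ge ⟨⟨h1, h2⟩, hp⟩)
      linarith [W.sq_le h1 h2 hp]
  simp only [zero_mul, add_zero, neg_one_mul, ← sub_eq_add_neg] at h
  have h1 := W.scal_cone_ge ht₀ ht ht₁ hκ
  have h2 := W.scalDens_integral_le (by linarith) ht₁ ha hat
  have h3 := W.scalDens_integral_ge ht₀ (by linarith) ha (by linarith) hs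
  have i : IntervalIntegrable (fun t => scalFlux u (t, a)) volume t₀ t₁ := by
    refine ContinuousOn.intervalIntegrable_of_Icc ht
      (W.contDiffOn_scalFlux.continuousOn.comp (by fun_prop) fun t ht' => ?_)
    exact ⟨⟨ht₀.trans_le ht'.1, ht'.2.trans_lt ht₁⟩, ha⟩
  have h4 := intervalIntegral.integral_mono_on ht i intervalIntegrable_const fun t ht' =>
    scalFlux_le (ht₀.trans_le ht'.1) (ht'.2.trans_lt ht₁) ha ha'
      (hax t a (ht₀.trans_le ht'.1) ht'.2 ha ha') hK
  rw [intervalIntegral.integral_const, smul_eq_mul] at h4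
  have h5 : (t₁ - t₀) * (3 * K ^ 2 * a) ≤ 3 * K ^ 2 * a :=
    mul_le_of_le_one_left (by positivity) (by linarith)
  have h6 : (2 * E + 4) * -t₀ * (t₁ - t₀) ≤ (2 * E + 4) * t₀ ^ 2 := by
    have hE := W.energy_nonneg
    have : -t₀ * (t₁ - t₀) ≤ t₀ ^ 2 := by nlinarith
    nlinarith
  linarith

lemma outDens_slice_le (W : FiniteEnergyWave u E) {t κ a s : ℝ} (ht : -1 < t) (ht' : t < 0)
    (hκ : ∀ t₁, t ≤ t₁ → t₁ < 0 → ∫ t in t..t₁, outDens u (t, 0 - t) ≤ κ)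
    (ha : 0 < a) (hat : a ≤ 0 - t) (hs : 0 < s) :
    ∫ r in a..(0 - t), outDens u (t, r) ≤
      2 * s * E + 6 * κ + ((2 * E + 1) / s + (6 * E + 9)) * -t := by
  suffices h : -t / 2 * (∫ r in a..(0 - t), outDens u (t, r)) ≤
      -t * (s * E + (2 * E + 1) / (2 * s) * -t) +
      -t * (3 * κ + (2 * E + 1) / 2 * -t) + (2 * E + 4) * t ^ 2 by
    have e : -t * (s * E + (2 * E + 1) / (2 * s) * -t) +
      -t * (3 * κ + (2 * E + 1) / 2 * -t) + (2 * E + 4) * t ^ 2 = -t / 2 *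
      (2 * s * E + 6 * κ + ((2 * E + 1) / s + (6 * E + 9)) * -t) := by field_simp; ring
    rw [e] at h
    exact le_of_mul_le_mul_left h (by linarith)
  set R := -t * (s * E + (2 * E + 1) / (2 * s) * -t) +
      -t * (3 * κ + (2 * E + 1) / 2 * -t) + (2 * E + 4) * t ^ 2 with hR
  have hlim : Tendsto (fun t₁ : ℝ => R + -t₁ * (4 * E + 1)) (𝓝[<] 0) (𝓝 R) := by
    have : Continuous fun t₁ : ℝ => R + -t₁ * (4 * E + 1) := by fun_prop
    simpa using (this.tendsto 0).mono_left nhdsWithin_le_nhds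
  refine ge_of_tendsto hlim ?_
  filter_upwards [Ioo_mem_nhdsLT ht'] with t₁ ht₁
  obtain ⟨K, hK, hax⟩ := W.axis t₁ ht₁.2
  have hlim2 : Tendsto (fun b : ℝ => R + -t₁ * (4 * E + 1) + 3 * K ^ 2 * b) (𝓝[>] 0)
      (𝓝 (R + -t₁ * (4 * E + 1))) := by
    have : Continuous fun b : ℝ => R + -t₁ * (4 * E + 1) + 3 * K ^ 2 * b := by fun_prop
    simpa using (this.tendsto 0).mono_left nhdsWithin_le_nhds
  refine ge_of_tendsto hlim2 ?_
  filter_upwards [Ioo_mem_nhdsGT (lt_min ha (lt_min (neg_pos.2 ht₁.2) one_half_pos))] with b hb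
  have hba : b ≤ a := hb.2.le.trans (min_le_left _ _)
  have hb1 : b ≤ -t₁ := hb.2.le.trans ((min_le_right _ _).trans (min_le_left _ _))
  have hb2 : b ≤ 1 / 2 := hb.2.le.trans ((min_le_right _ _).trans (min_le_right _ _))
  have h := W.scal_estimate ht ht₁.1.le ht₁.2 (hκ t₁ ht₁.1.le ht₁.2) hb.1 (by linarith) hb2 hK hs hax
  have h2 : ∫ r in a..(0 - t), outDens u (t, r) ≤ ∫ r in b..(0 - t), outDens u (t, r) := by
    rw [← intervalIntegral.integral_add_adjacent_intervals
      (integrable_slice W.contDiffOn_outDens ht ht' hb.1 hba)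
      (integrable_slice W.contDiffOn_outDens ht ht' ha hat)]
    have : 0 ≤ ∫ r in b..a, outDens u (t, r) :=
      intervalIntegral.integral_nonneg hba fun r _ => outDens_nonneg u _
    linarith
  have h3 := mul_le_mul_of_nonneg_left h2 (show 0 ≤ -t / 2 by linarith)
  linarith

end FiniteEnergyWave

namespace FiniteEnergyWave

variable {u : ℝ → ℝ → ℝ} {E : ℝ}

lemma coneDens_integral_le (W : FiniteEnergyWave u E) {t₀ t₁ η κ S L : ℝ} (ht₀ : -(1 / 2) ≤ t₀)
    (ht : t₀ ≤ t₁) (hη : 0 ≤ η) (ht₁ : t₁ < -η)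
    (hκ : ∫ t in t₀..t₁, outDens u (t, 0 - t) ≤ κ)
    (hS : ∀ t a, t₀ ≤ t → t < 0 → 0 < a → a ≤ 0 - t → ∫ r in a..(0 - t), outDens u (t, r) ≤ S)
    (hL : ∀ t a, t₀ ≤ t → t < 0 → 0 < a → a ≤ 0 - t →
      ∫ r in a..(0 - t), |r * u t r * ut u t r| ≤ L) :
    ∫ t in t₀..t₁, coneDens u (t, -η - t) ≤ 3 * κ + (2 * E + 1) * -t₀ + S + 2 * L := by
  have hE := W.energy_nonneg
  have h := W.strip_cone_le ht₀ ht hη ht₁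
  have ht₀' : -1 < t₀ := by linarith
  have ht₁' : t₁ < 0 := by linarith
  have j1 := integrable_cone W.contDiffOn_outDens ht₀' ht ht₁' ht₁'
  have h1 := intervalIntegral.integral_mono_on ht
    (integrable_cone W.contDiffOn_coneDens ht₀' ht ht₁' ht₁')
    ((j1.const_mul 3).add (intervalIntegrable_const (c := 2 * E + 1))) fun t ht' =>
      (coneDens_le u (t, 0 - t)).trans (add_le_add le_rfl
        (W.sq_le (by linarith [ht'.1]) (by linarith [ht'.2]) (by dsimp only; linarith [ht'.2])))
  rw [intervalIntegral.integral_add (j1.const_mul 3) intervalIntegrable_const,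
    intervalIntegral.integral_const_mul, intervalIntegral.integral_const, smul_eq_mul] at h1
  have h2 : (t₁ - t₀) * (2 * E + 1) ≤ (2 * E + 1) * -t₀ := by nlinarith
  have e : ∀ t, t₀ ≤ t → t ≤ t₁ → (∫ r in (-η - t)..(0 - t), radDens u (t, r)) =
      (∫ r in (-η - t)..(0 - t), outDens u (t, r)) -
        ∫ r in (-η - t)..(0 - t), r * u t r * ut u t r := fun t h0 h1 =>
    intervalIntegral.integral_sub
      (integrable_slice W.contDiffOn_outDens (by linarith) (by linarith) (by linarith) (by linarith))
      (W.intervalIntegrable_mul_ut (by linarith) (by linarith) (by linarith) (by linarith))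
  have l : ∀ t, t₀ ≤ t → t ≤ t₁ → |∫ r in (-η - t)..(0 - t), r * u t r * ut u t r| ≤ L :=
    fun t h0 h1 => (intervalIntegral.abs_integral_le_integral_abs (by linarith)).trans
      (hL t _ h0 (by linarith) (by linarith) (by linarith))
  have p : 0 ≤ ∫ r in (-η - t₀)..(0 - t₀), outDens u (t₀, r) :=
    intervalIntegral.integral_nonneg (by linarith) fun r _ => outDens_nonneg u _
  rw [e t₁ ht le_rfl, e t₀ le_rfl ht] at h
  have l1 := (abs_le.1 (l t₁ ht le_rfl)).1
  have l0 := (abs_le.1 (l t₀ le_rfl ht)).2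
  have s1 := hS t₁ (-η - t₁) ht (by linarith) (by linarith) (by linarith)
  linarith

lemma skyrmePrim_le_of_cone (W : FiniteEnergyWave u E) {t₀ r₀ F Q s : ℝ} (ht₀ : -1 < t₀)
    (hr₀ : 0 < r₀) (hr : r₀ < -t₀) (hs : 0 < s)
    (hF : ∀ t₁, t₀ ≤ t₁ → t₁ < t₀ + r₀ → ∫ t in t₀..t₁, outDens u (t, t₀ + r₀ - t) ≤ F)
    (hQ : ∀ t₁, t₀ ≤ t₁ → t₁ < t₀ + r₀ → ∫ t in t₀..t₁, coneDens u (t, t₀ + r₀ - t) ≤ Q) :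
    skyrmePrim (u t₀ r₀) ≤ s * F + Q / s := by
  set c := t₀ + r₀ with hc
  obtain ⟨K, hK, hax⟩ := W.axis c (by linarith)
  have hlim : Tendsto (fun t : ℝ => (K * (c - t)) ^ 2 / 2 + (s * F + Q / s)) (𝓝[<] c)
      (𝓝 (s * F + Q / s)) := by
    have : Continuous fun t : ℝ => (K * (c - t)) ^ 2 / 2 + (s * F + Q / s) := by fun_prop
    simpa using (this.tendsto c).mono_left nhdsWithin_le_nhds
  refine ge_of_tendsto hlim ?_
  filter_upwards [Ioo_mem_nhdsLT (max_lt (show t₀ < c by linarith) (show c - 1 / 2 < c by linarith))]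
    with t ht
  have h0 : t₀ ≤ t := (le_max_left _ _).trans ht.1.le
  have h1 : c - 1 / 2 ≤ t := (le_max_right _ _).trans ht.1.le
  have h := W.skyrmePrim_le_cone ht₀ h0 (by linarith [ht.2]) ht.2 hs
  have h2 := skyrmePrim_le (u t (c - t))
  have h3 := sq_le_sq.2 (((hax t (c - t) (by linarith) ht.2.le (by linarith [ht.2])
    (by linarith)).1).trans (le_abs_self _))
  have h4 := mul_le_mul_of_nonneg_left (hF t h0 ht.2) hs.le
  have h5 := div_le_div_of_nonneg_right (hQ t h0 ht.2) hs.le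
  rw [show c - t₀ = r₀ by linarith] at h
  linarith

lemma exists_skyrmePrim_le_inside (W : FiniteEnergyWave u E) {ε : ℝ} (hε : 0 < ε) :
    ∃ T, -1 < T ∧ T < 0 ∧ ∀ t r, T < t → t < 0 → 0 < r → r < -t → skyrmePrim (u t r) ≤ ε := by
  have hE := W.energy_nonneg
  set δ := ε / (2 * (E + 1)) with hδ
  have hδ0 : 0 < δ := by positivity
  set q := δ * (ε / 2) with hq
  have hq0 : 0 < q := by positivity
  set s := q / (12 * (E + 1)) with hs
  have hs0 : 0 < s := by positivity
  set C := (2 * E + 1) + 2 * ((2 * E + 1) / s) + (6 * E + 9) with hC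
  have hC0 : 0 < C := by positivity
  obtain ⟨T, hT1, hT2, hT⟩ := W.exists_cone_flux_le (κ := min 1 (q / 27)) (by positivity)
  set κ := min 1 (q / 27) with hκ
  refine ⟨max T (-(q / (3 * C))), by linarith [le_max_left T (-(q / (3 * C)))],
    max_lt hT2 (by rw [neg_lt_zero]; positivity), fun t₀ r₀ h0 h1 h2 h3 => ?_⟩
  have hT0 : T ≤ t₀ := (le_max_left _ _).trans h0.le
  have ht0 : -t₀ * C ≤ q / 3 := by
    have : -t₀ ≤ q / (3 * C) := by linarith [le_max_right T (-(q / (3 * C)))]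
    calc -t₀ * C ≤ q / (3 * C) * C := by gcongr
      _ = q / 3 := by field_simp
  have hflux : ∀ t₁, t₀ ≤ t₁ → t₁ < 0 → ∫ t in t₀..t₁, outDens u (t, 0 - t) ≤ κ :=
    fun t₁ a b => hT t₀ t₁ hT0 a b
  have hmain := W.skyrmePrim_le_of_cone (F := E + κ)
    (Q := 3 * κ + (2 * E + 1) * -t₀ + (2 * s * E + 6 * κ + ((2 * E + 1) / s + (6 * E + 9)) * -t₀)
      + 2 * (s * E + (2 * E + 1) / (2 * s) * -t₀)) (by linarith) h2 h3 hδ0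
    (fun t₁ a b => by
      have := W.strip_flux_le (η := -(t₀ + r₀)) (by linarith) a (by linarith) (by linarith)
      rw [neg_neg] at this
      linarith [hflux t₁ a (by linarith)])
    (fun t₁ a b => by
      have := W.coneDens_integral_le (η := -(t₀ + r₀)) (by linarith) a (by linarith) (by linarith)
        (hflux t₁ a (by linarith)) (S := 2 * s * E + 6 * κ + ((2 * E + 1) / s + (6 * E + 9)) * -t₀)
        (L := s * E + (2 * E + 1) / (2 * s) * -t₀)
        (fun t a' k1 k2 k3 k4 => (W.outDens_slice_le (by linarith) k2
          (fun t₁ k5 k6 => hT t t₁ (hT0.trans k1) k5 k6) k3 k4 hs0).trans (by gcongr))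
        (fun t a' k1 k2 k3 k4 => (W.integral_abs_mul_ut_le (by linarith) k2 k3 k4 hs0).trans
          (by gcongr; linarith))
      rwa [neg_neg] at this)
  have e : 3 * κ + (2 * E + 1) * -t₀ + (2 * s * E + 6 * κ + ((2 * E + 1) / s + (6 * E + 9)) * -t₀)
      + 2 * (s * E + (2 * E + 1) / (2 * s) * -t₀) = 9 * κ + 4 * s * E + -t₀ * C := by
    simp only [hC]; field_simp; ring
  have hκ1 : κ ≤ 1 := min_le_left _ _
  have hκ2 : κ ≤ q / 27 := min_le_right _ _
  have hsE : 4 * s * E ≤ q / 3 := by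
    have : s * (12 * (E + 1)) = q := by simp only [hs]; field_simp
    nlinarith
  have k1 : (3 * κ + (2 * E + 1) * -t₀ + (2 * s * E + 6 * κ + ((2 * E + 1) / s + (6 * E + 9)) * -t₀)
      + 2 * (s * E + (2 * E + 1) / (2 * s) * -t₀)) / δ ≤ ε / 2 := by
    rw [e, div_le_iff₀ hδ0]; linarith
  have k2 : δ * (E + κ) ≤ ε / 2 := by
    calc δ * (E + κ) ≤ δ * (E + 1) := by gcongr
      _ = ε / 2 := by simp only [hδ]; field_simp
  linarith

lemma skyrmePrim_le_on_cone (W : FiniteEnergyWave u E) {t ε : ℝ} (ht : -1 < t) (ht' : t < 0)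
    (h : ∀ r, 0 < r → r < -t → skyrmePrim (u t r) ≤ ε) : skyrmePrim (u t (-t)) ≤ ε := by
  have hd := (hasDerivAt_skyrmePrim _).continuousAt.comp
    (W.hasDerivAt_r t (-t) ⟨⟨ht, ht'⟩, neg_pos.2 ht'⟩).continuousAt
  refine le_of_tendsto (hd.tendsto.mono_left (nhdsWithin_le_nhds (s := Iio (-t)))) ?_
  filter_upwards [Ioo_mem_nhdsLT (neg_pos.2 ht')] with r hr using h r hr.1 hr.2

lemma exists_skyrmePrim_le_outside (W : FiniteEnergyWave u E) {ε : ℝ} (hε : 0 < ε) :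
    ∃ T δ, T < 0 ∧ 0 < δ ∧ ∀ t r, T < t → t < 0 → -t ≤ r → r ≤ δ - t →
      skyrmePrim (u t r) ≤ skyrmePrim (u t (-t)) + ε := by
  obtain ⟨T, hT1, hT2, hT⟩ := W.exists_cone_flux_le (κ := ε / 2) (by positivity)
  have hc : ContinuousOn (fun r => enDens u (T, r)) (Icc (-T) (-T + 1)) :=
    continuousOn_slice W.contDiffOn_enDens.continuousOn (by linarith) hT2 (by linarith)
  obtain ⟨B, hB⟩ := isCompact_Icc.exists_bound_of_continuousOn hc
  set δ := min 1 (ε / (2 * (|B| + 1))) with hδ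
  have hδ0 : 0 < δ := by positivity
  refine ⟨T, δ, hT2, hδ0, fun t r h0 h1 h2 h3 => ?_⟩
  have hs := W.skyrmePrim_le_slice (a := -t) (b := r) (by linarith) h1 (by linarith) h2
  have hstrip := W.outer_strip_energy_le (δ := δ) (by linarith) h0.le hδ0.le h1
  have hflux := hT T t le_rfl h0.le h1
  have h4 : ∫ r in (0 - T)..(δ - T), enDens u (T, r) ≤ ε / 2 := by
    have := intervalIntegral.norm_integral_le_of_norm_le_const (E := ℝ)
      (f := fun r => enDens u (T, r)) (a := 0 - T) (b := δ - T) (C := B) fun r hr => by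
        rw [uIoc_of_le (by linarith)] at hr
        exact hB r ⟨by linarith [hr.1], by linarith [hr.2, min_le_left 1 (ε / (2 * (|B| + 1)))]⟩
    rw [Real.norm_eq_abs, show δ - T - (0 - T) = δ by ring, abs_of_pos hδ0] at this
    calc ∫ r in (0 - T)..(δ - T), enDens u (T, r) ≤ B * δ := (le_abs_self _).trans this
      _ ≤ (|B| + 1) * (ε / (2 * (|B| + 1))) := by
        have := le_abs_self B
        exact mul_le_mul (by linarith) (min_le_right _ _) hδ0.le (by positivity)
      _ = ε / 2 := by field_simp
  have h5 : ∫ x in (-t)..r, enDens u (t, x) ≤ ∫ x in (0 - t)..(δ - t), enDens u (t, x) := by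
    rw [zero_sub, ← intervalIntegral.integral_add_adjacent_intervals
      (integrable_slice W.contDiffOn_enDens (by linarith) h1 (by linarith) h2)
      (integrable_slice W.contDiffOn_enDens (by linarith) h1 (by linarith) h3)]
    have : 0 ≤ ∫ x in r..(δ - t), enDens u (t, x) :=
      intervalIntegral.integral_nonneg h3 fun r _ => enDens_nonneg u _
    linarith
  linarith

lemma exists_skyrmePrim_le (W : FiniteEnergyWave u E) {ε : ℝ} (hε : 0 < ε) :
    ∃ δ > 0, ∀ t r, -δ < t → t < 0 → 0 < r → r < δ → skyrmePrim (u t r) ≤ ε := by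
  obtain ⟨T, hT1, hT2, hT⟩ := W.exists_skyrmePrim_le_inside (half_pos hε)
  obtain ⟨T', δ, hT', hδ, hout⟩ := W.exists_skyrmePrim_le_outside (half_pos hε)
  refine ⟨min δ (min (-T) (-T')), lt_min hδ (lt_min (by linarith) (by linarith)),
    fun t r h0 h1 h2 h3 => ?_⟩
  have m1 := min_le_left δ (min (-T) (-T'))
  have m2 := (min_le_right δ (min (-T) (-T'))).trans (min_le_left _ _)
  have m3 := (min_le_right δ (min (-T) (-T'))).trans (min_le_right _ _)
  have hin := fun r => hT t r (by linarith) h1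
  rcases lt_or_ge r (-t) with h | h
  · linarith [hin r h2 h]
  · have := hout t r (by linarith) h1 h (by linarith)
    linarith [W.skyrmePrim_le_on_cone (by linarith) h1 hin]

end FiniteEnergyWave

/-- Continuity at the origin: `u(t,r) → 0` as `(t,r) → (0,0)` with `t < 0`, `0 ≤ r`. -/
theorem continuity_at_origin
    (u : ℝ → ℝ → ℝ)
    (hreg : ContDiffOn ℝ (⊤ : ℕ∞) (fun p : ℝ × ℝ => u p.1 p.2)
      ((Set.Icc (-1 : ℝ) 0 ×ˢ Set.Ici (0 : ℝ)) \ {((0 : ℝ), (0 : ℝ))}))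
    (hPDE : ∀ t ∈ Set.Ico (-1 : ℝ) 0, ∀ r : ℝ, 0 < r → ANeq u t r)
    (hbc0 : ∀ t ∈ Set.Ico (-1 : ℝ) 0, u t 0 = 0)
    (hbcinf : ∀ t ∈ Set.Ico (-1 : ℝ) 0, Tendsto (u t) atTop (𝓝 Real.pi))
    (hfin : ∀ t ∈ Set.Ico (-1 : ℝ) 0, IntegrableOn (fun r => eDens u t r * r ^ 2) (Set.Ioi 0))
    (hcons : ∀ t ∈ Set.Ico (-1 : ℝ) 0,
      ∫ r in Set.Ioi (0 : ℝ), eDens u t r * r ^ 2 =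
        ∫ r in Set.Ioi (0 : ℝ), eDens u (-1 : ℝ) r * r ^ 2)
    :
    Tendsto (fun p : ℝ × ℝ => u p.1 p.2)
      (𝓝[Set.Iio (0 : ℝ) ×ˢ Set.Ici (0 : ℝ)] ((0 : ℝ), (0 : ℝ))) (𝓝 0) := by
  have W := finiteEnergyWave_of_regular hreg hPDE hbc0 hfin hcons
  refine Metric.tendsto_nhds.2 fun ε hε => ?_
  obtain ⟨δ, hδ, h⟩ := W.exists_skyrmePrim_le (half_pos (skyrmePrim_pos hε))
  have hn : Ioo (-(min δ 1)) (min δ 1) ×ˢ Ioo (-(min δ 1)) (min δ 1) ∈ 𝓝 ((0 : ℝ), (0 : ℝ)) := by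
    have : 0 < min δ 1 := lt_min hδ one_pos
    exact prod_mem_nhds (Ioo_mem_nhds (by linarith) this) (Ioo_mem_nhds (by linarith) this)
  filter_upwards [self_mem_nhdsWithin, mem_nhdsWithin_of_mem_nhds hn]
  rintro ⟨t, r⟩ ⟨h1, h2⟩ ⟨h3, h4⟩
  simp only [mem_Iio, mem_Ici, mem_Ioo] at h1 h2 h3 h4
  rw [Real.dist_eq, sub_zero]
  have m1 := min_le_left δ 1
  have m2 := min_le_right δ 1
  rcases h2.eq_or_lt with h0 | h0
  · rw [← h0, hbc0 t ⟨by linarith, h1⟩, abs_zero]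
    exact hε
  · refine abs_lt_of_skyrmePrim_lt hε ?_
    linarith [h t r (by linarith) h1 h0 (by linarith), skyrmePrim_pos hε]
end

section
/- In the backward framework, the local energy is monotone: for all 0 < t₀ ≤ t₁ ≤ T̄ one has E(t₀) ≤ E(t₁). -/
open Real MeasureTheory Set Filter Topology

/-- The backward domain `D(T̄)`. -/
def Dom (T : ℝ) : Set (ℝ × ℝ) :=
  {p : ℝ × ℝ | 0 < p.1 ∧ p.1 ≤ 2 * T ∧ 0 ≤ p.2 ∧ p.2 ≤ min (2 * T - p.1) p.1}

/-- The local energy `E(t) = ∫_0^t e(t,r) r² dr`. -/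
noncomputable def locE (u : ℝ → ℝ → ℝ) (t : ℝ) : ℝ := ∫ r in (0 : ℝ)..t, eDens u t r * r ^ 2

/-- The flux `F(t₀, t₁)` through the light cone `t = r`. -/
noncomputable def flux (u : ℝ → ℝ → ℝ) (t₀ t₁ : ℝ) : ℝ :=
  ∫ r in t₀..t₁,
    ((1 / 2) * uplus u r r ^ 2 + Real.sin (u r r) ^ 2 / r ^ 2 +
      (u r r - Real.sin (u r r) * Real.cos (u r r)) ^ 2 / (2 * r ^ 4)) * r ^ 2

/-- The backward framework: `u` is smooth on a neighborhood of `D(T̄)`, solves the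
Adkins–Nappi equation on `D(T̄)` (for `r > 0`), and has finite energy `E(T̄)`. -/
def BackwardFramework (u : ℝ → ℝ → ℝ) (T : ℝ) : Prop :=
  0 < T ∧
  (∃ V : Set (ℝ × ℝ), IsOpen V ∧ Dom T ⊆ V ∧
    ContDiffOn ℝ (⊤ : ℕ∞) (fun p : ℝ × ℝ => u p.1 p.2) V) ∧
  (∀ p ∈ Dom T, 0 < p.2 → ANeq u p.1 p.2) ∧
  IntegrableOn (fun r => eDens u T r * r ^ 2) (Set.Ioc 0 T)


section PartialDerivatives

variable {F : ℝ → ℝ → ℝ} {V : Set (ℝ × ℝ)} {t r : ℝ}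

lemma hasFDerivAt_of_contDiffOn (hV : IsOpen V)
    (hF : ContDiffOn ℝ (⊤ : ℕ∞) (fun p : ℝ × ℝ => F p.1 p.2) V) {p : ℝ × ℝ} (hp : p ∈ V) :
    HasFDerivAt (fun p : ℝ × ℝ => F p.1 p.2) (fderiv ℝ (fun p : ℝ × ℝ => F p.1 p.2) p) p :=
  ((hF.contDiffAt (hV.mem_nhds hp)).differentiableAt (by simp)).hasFDerivAt

lemma HasFDerivAt.hasDerivAt_fst {L : ℝ × ℝ →L[ℝ] ℝ}
    (h : HasFDerivAt (fun p : ℝ × ℝ => F p.1 p.2) L (t, r)) :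
    HasDerivAt (fun s => F s r) (L (1, 0)) t :=
  h.comp_hasDerivAt (f := fun s : ℝ => (s, r)) t ((hasDerivAt_id t).prodMk (hasDerivAt_const t r))

lemma HasFDerivAt.hasDerivAt_snd {L : ℝ × ℝ →L[ℝ] ℝ}
    (h : HasFDerivAt (fun p : ℝ × ℝ => F p.1 p.2) L (t, r)) :
    HasDerivAt (fun s => F t s) (L (0, 1)) r :=
  h.comp_hasDerivAt (f := fun s : ℝ => (t, s)) r ((hasDerivAt_const r t).prodMk (hasDerivAt_id r))

lemma ut_eq_fderiv (hV : IsOpen V)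
    (hF : ContDiffOn ℝ (⊤ : ℕ∞) (fun p : ℝ × ℝ => F p.1 p.2) V) {p : ℝ × ℝ} (hp : p ∈ V) :
    ut F p.1 p.2 = fderiv ℝ (fun p : ℝ × ℝ => F p.1 p.2) p (1, 0) :=
  (hasFDerivAt_of_contDiffOn hV hF hp).hasDerivAt_fst.deriv

lemma ur_eq_fderiv (hV : IsOpen V)
    (hF : ContDiffOn ℝ (⊤ : ℕ∞) (fun p : ℝ × ℝ => F p.1 p.2) V) {p : ℝ × ℝ} (hp : p ∈ V) :
    ur F p.1 p.2 = fderiv ℝ (fun p : ℝ × ℝ => F p.1 p.2) p (0, 1) :=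
  (hasFDerivAt_of_contDiffOn hV hF hp).hasDerivAt_snd.deriv

lemma hasDerivAt_ut (hV : IsOpen V)
    (hF : ContDiffOn ℝ (⊤ : ℕ∞) (fun p : ℝ × ℝ => F p.1 p.2) V) (hp : (t, r) ∈ V) :
    HasDerivAt (fun s => F s r) (ut F t r) t :=
  (hasFDerivAt_of_contDiffOn hV hF hp).hasDerivAt_fst.differentiableAt.hasDerivAt

lemma hasDerivAt_ur (hV : IsOpen V)
    (hF : ContDiffOn ℝ (⊤ : ℕ∞) (fun p : ℝ × ℝ => F p.1 p.2) V) (hp : (t, r) ∈ V) :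
    HasDerivAt (fun s => F t s) (ur F t r) r :=
  (hasFDerivAt_of_contDiffOn hV hF hp).hasDerivAt_snd.differentiableAt.hasDerivAt

lemma contDiffOn_ut (hV : IsOpen V)
    (hF : ContDiffOn ℝ (⊤ : ℕ∞) (fun p : ℝ × ℝ => F p.1 p.2) V) :
    ContDiffOn ℝ (⊤ : ℕ∞) (fun p : ℝ × ℝ => ut F p.1 p.2) V :=
  ((hF.fderiv_of_isOpen (m := (⊤ : ℕ∞)) hV (by simp)).clm_apply contDiffOn_const).congr
    fun _ hp => ut_eq_fderiv hV hF hp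

lemma contDiffOn_ur (hV : IsOpen V)
    (hF : ContDiffOn ℝ (⊤ : ℕ∞) (fun p : ℝ × ℝ => F p.1 p.2) V) :
    ContDiffOn ℝ (⊤ : ℕ∞) (fun p : ℝ × ℝ => ur F p.1 p.2) V :=
  ((hF.fderiv_of_isOpen (m := (⊤ : ℕ∞)) hV (by simp)).clm_apply contDiffOn_const).congr
    fun _ hp => ur_eq_fderiv hV hF hp

/-- Equality of mixed partial derivatives. -/
lemma ut_ur_comm (hV : IsOpen V)
    (hF : ContDiffOn ℝ (⊤ : ℕ∞) (fun p : ℝ × ℝ => F p.1 p.2) V) (hp : (t, r) ∈ V) :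
    ut (ur F) t r = ur (ut F) t r := by
  have hd : HasFDerivAt (fderiv ℝ (fun p : ℝ × ℝ => F p.1 p.2))
      (fderiv ℝ (fderiv ℝ (fun p : ℝ × ℝ => F p.1 p.2)) (t, r)) (t, r) :=
    (((hF.fderiv_of_isOpen (m := (⊤ : ℕ∞)) hV (by simp)).contDiffAt
      (hV.mem_nhds hp)).differentiableAt (by simp)).hasFDerivAt
  have key : ∀ v : ℝ × ℝ, HasFDerivAt (fun p => fderiv ℝ (fun p : ℝ × ℝ => F p.1 p.2) p v)
      ((fderiv ℝ (fderiv ℝ (fun p : ℝ × ℝ => F p.1 p.2)) (t, r)).flip v) (t, r) := fun v => by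
    simpa using hd.clm_apply (hasFDerivAt_const v (t, r))
  have h1 : HasFDerivAt (fun p : ℝ × ℝ => ur F p.1 p.2) _ (t, r) :=
    (key (0, 1)).congr_of_eventuallyEq
      ((hV.eventually_mem hp).mono fun p hp => ur_eq_fderiv hV hF hp)
  have h2 : HasFDerivAt (fun p : ℝ × ℝ => ut F p.1 p.2) _ (t, r) :=
    (key (1, 0)).congr_of_eventuallyEq
      ((hV.eventually_mem hp).mono fun p hp => ut_eq_fderiv hV hF hp)
  have hs : IsSymmSndFDerivAt ℝ (fun p : ℝ × ℝ => F p.1 p.2) (t, r) :=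
    (hF.contDiffAt (hV.mem_nhds hp)).isSymmSndFDerivAt (by
      rw [minSmoothness_of_isRCLikeNormedField]; exact WithTop.coe_le_coe.2 le_top)
  calc ut (ur F) t r = _ := h1.hasDerivAt_fst.deriv
    _ = _ := by simpa using hs (1, 0) (0, 1)
    _ = ur (ut F) t r := h2.hasDerivAt_snd.deriv.symm

end PartialDerivatives

/-- Green's theorem on the trapezoid `{(t, r) : t₀ ≤ t ≤ t₁, ε ≤ r ≤ t}` for a conservation law
`∂ₜ g = ∂ᵣ h`. -/
lemma integral_trapezoid_of_conservation {g h : ℝ × ℝ → ℝ} {t₀ t₁ ε : ℝ} (hε : ε ≤ t₀)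
    (ht : t₀ ≤ t₁)
    (hg : ∀ t ∈ Icc t₀ t₁, ∀ r ∈ Icc ε t, DifferentiableAt ℝ g (t, r))
    (hh : ∀ t ∈ Icc t₀ t₁, ∀ r ∈ Icc ε t, DifferentiableAt ℝ h (t, r))
    (hgh : ∀ t ∈ Icc t₀ t₁, ∀ r ∈ Icc ε t,
      fderiv ℝ g (t, r) (1, 0) = fderiv ℝ h (t, r) (0, 1)) :
    (∫ r in ε..t₁, g (t₁, r)) - ∫ r in ε..t₀, g (t₀, r) =
      (∫ t in t₀..t₁, (g (t, t) + h (t, t))) - ∫ t in t₀..t₁, h (t, ε) := by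
  let φ : ℝ × ℝ → ℝ × ℝ := fun p => (p.1, ε + p.2 * (p.1 - ε))
  let φ' : ℝ × ℝ → ℝ × ℝ →L[ℝ] ℝ × ℝ := fun p =>
    (ContinuousLinearMap.fst ℝ ℝ ℝ).prod
      (p.2 • ContinuousLinearMap.fst ℝ ℝ ℝ + (p.1 - ε) • ContinuousLinearMap.snd ℝ ℝ ℝ)
  have hφ : ∀ p, HasFDerivAt φ (φ' p) p := fun p =>
    hasFDerivAt_fst.prodMk ((hasFDerivAt_snd.mul (hasFDerivAt_fst.sub_const ε)).const_add ε)
  have hmem : ∀ p ∈ uIcc t₀ t₁ ×ˢ uIcc (0 : ℝ) 1,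
      p.1 ∈ Icc t₀ t₁ ∧ ε + p.2 * (p.1 - ε) ∈ Icc ε p.1 := by
    rintro ⟨a, s⟩ ⟨ha, hs⟩
    rw [uIcc_of_le ht] at ha
    rw [uIcc_of_le zero_le_one] at hs
    simp only [mem_Icc] at ha hs ⊢
    exact ⟨ha, by nlinarith [mul_nonneg hs.1 (show 0 ≤ a - ε by linarith)],
      by nlinarith [mul_nonneg (sub_nonneg.2 hs.2) (show 0 ≤ a - ε by linarith)]⟩
  have hG : ∀ p ∈ uIcc t₀ t₁ ×ˢ uIcc (0 : ℝ) 1, HasFDerivAt (fun p => (p.1 - ε) * g (φ p))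
      ((p.1 - ε) • (fderiv ℝ g (φ p)).comp (φ' p) + g (φ p) • ContinuousLinearMap.fst ℝ ℝ ℝ) p :=
    fun p hp => (hasFDerivAt_fst.sub_const ε).mul
      (((hg _ (hmem p hp).1 _ (hmem p hp).2).hasFDerivAt).comp p (hφ p))
  have hH : ∀ p ∈ uIcc t₀ t₁ ×ˢ uIcc (0 : ℝ) 1,
      HasFDerivAt (fun p => -(p.2 * g (φ p) + h (φ p)))
      (-(p.2 • (fderiv ℝ g (φ p)).comp (φ' p) + g (φ p) • ContinuousLinearMap.snd ℝ ℝ ℝ +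
        (fderiv ℝ h (φ p)).comp (φ' p))) p :=
    fun p hp => ((hasFDerivAt_snd.mul
      (((hg _ (hmem p hp).1 _ (hmem p hp).2).hasFDerivAt).comp p (hφ p))).add
      (((hh _ (hmem p hp).1 _ (hmem p hp).2).hasFDerivAt).comp p (hφ p))).neg
  have hsub : Ioo (min t₀ t₁) (max t₀ t₁) ×ˢ Ioo (min (0 : ℝ) 1) (max 0 1) ⊆
      uIcc t₀ t₁ ×ˢ uIcc (0 : ℝ) 1 := prod_mono Ioo_subset_Icc_self Ioo_subset_Icc_self
  have hdiv : ∀ p ∈ uIcc t₀ t₁ ×ˢ uIcc (0 : ℝ) 1,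
      ((p.1 - ε) • (fderiv ℝ g (φ p)).comp (φ' p) + g (φ p) • ContinuousLinearMap.fst ℝ ℝ ℝ) (1, 0)
      + (-(p.2 • (fderiv ℝ g (φ p)).comp (φ' p) + g (φ p) • ContinuousLinearMap.snd ℝ ℝ ℝ +
        (fderiv ℝ h (φ p)).comp (φ' p))) (0, 1) = 0 := by
    intro p hp
    have h1 : ((1 : ℝ), p.2) = (1, 0) + p.2 • (0, 1) := by simp
    have h2 : ((0 : ℝ), p.1 - ε) = (p.1 - ε) • (0, 1) := by simp
    have h3 := hgh _ (hmem p hp).1 _ (hmem p hp).2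
    simp only [add_apply, neg_apply,
      smul_apply, ContinuousLinearMap.comp_apply, φ',
      ContinuousLinearMap.prod_apply, ContinuousLinearMap.coe_fst', ContinuousLinearMap.coe_snd',
      smul_eq_mul, mul_one, mul_zero, add_zero, zero_add]
    rw [h1, h2]
    simp only [map_add, map_smul, smul_eq_mul, φ, h3]
    ring
  have hI := integral2_divergence_prod_of_hasFDerivAt _ _ _ _ t₀ 0 t₁ 1
    (fun p hp => (hG p hp).continuousAt.continuousWithinAt)
    (fun p hp => (hH p hp).continuousAt.continuousWithinAt)
    (fun p hp => hG p (hsub hp)) (fun p hp => hH p (hsub hp))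
    ((integrableOn_zero (μ := volume)).congr_fun (fun p hp => (hdiv p hp).symm)
      (measurableSet_uIcc.prod measurableSet_uIcc))
  have h0 : (∫ x in t₀..t₁, ∫ y in (0 : ℝ)..1,
      (((x, y).1 - ε) • (fderiv ℝ g (φ (x, y))).comp (φ' (x, y)) + g (φ (x, y)) •
        ContinuousLinearMap.fst ℝ ℝ ℝ) (1, 0)
      + (-((x, y).2 • (fderiv ℝ g (φ (x, y))).comp (φ' (x, y)) + g (φ (x, y)) •
        ContinuousLinearMap.snd ℝ ℝ ℝ + (fderiv ℝ h (φ (x, y))).comp (φ' (x, y)))) (0, 1)) = 0 := by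
    rw [intervalIntegral.integral_congr (g := fun _ => (0 : ℝ))]
    · simp
    · intro x hx
      dsimp only
      rw [intervalIntegral.integral_congr (g := fun _ => (0 : ℝ))]
      · simp
      · exact fun y hy => hdiv (x, y) ⟨hx, hy⟩
  rw [h0] at hI
  have hsubst : ∀ t, (∫ y in (0 : ℝ)..1, (t - ε) * g (φ (t, y))) = ∫ r in ε..t, g (t, r) := by
    intro t
    have := intervalIntegral.smul_integral_comp_mul_add (a := 0) (b := 1) (fun r => g (t, r))
      (t - ε) ε
    simp only [mul_zero, zero_add, mul_one, sub_add_cancel, smul_eq_mul] at this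
    rw [intervalIntegral.integral_const_mul, ← this]
    simp only [φ]
    congr 2
    ext y
    ring_nf
  simp only [hsubst, intervalIntegral.integral_neg] at hI
  simp only [φ, one_mul, zero_mul, add_zero, zero_add, add_sub_cancel] at hI
  linarith

lemma mem_Dom {T t r : ℝ} (ht : 0 < t) (htT : t ≤ T) (hr : 0 ≤ r) (hrt : r ≤ t) :
    (t, r) ∈ Dom T :=
  ⟨ht, by dsimp only; linarith, hr, le_min (by dsimp only; linarith) hrt⟩

lemma eq_zero_of_sub_sin_mul_cos_eq_zero {x : ℝ} (h : x - sin x * cos x = 0) : x = 0 := by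
  have h2 : sin (2 * x) = 2 * x := by rw [sin_two_mul]; linarith
  rcases lt_trichotomy x 0 with hx | hx | hx
  · have := sin_lt (show 0 < 2 * (-x) by linarith)
    rw [mul_neg, sin_neg] at this
    linarith
  · exact hx
  · have := sin_lt (show 0 < 2 * x by linarith)
    linarith

lemma sq_sub_sin_mul_cos_le (x : ℝ) : (x - sin x * cos x) ^ 2 ≤ 4 * x ^ 2 := by
  have h1 : |x - sin x * cos x| ≤ 2 * |x| := by
    calc |x - sin x * cos x| ≤ |x| + |sin x * cos x| := abs_sub _ _
      _ = |x| + |sin x| * |cos x| := by rw [abs_mul]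
      _ ≤ |x| + |x| * 1 :=
          add_le_add le_rfl (mul_le_mul abs_sin_le_abs (abs_cos_le_one x) (abs_nonneg _) (abs_nonneg _))
      _ = 2 * |x| := by ring
  calc (x - sin x * cos x) ^ 2 = |x - sin x * cos x| ^ 2 := (sq_abs _).symm
    _ ≤ (2 * |x|) ^ 2 := by gcongr
    _ = 4 * x ^ 2 := by rw [mul_pow, sq_abs]; norm_num

lemma eDens_nonneg (u : ℝ → ℝ → ℝ) (t r : ℝ) : 0 ≤ eDens u t r := by
  unfold eDens; positivity

/-- Finiteness of the energy at time `T` forces `u` to vanish at the origin. -/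
lemma origin_eq_zero_of_integrableOn {u : ℝ → ℝ → ℝ} {T : ℝ} (hT : 0 < T)
    (hc : ContinuousAt (u T) 0)
    (hi : IntegrableOn (fun r => eDens u T r * r ^ 2) (Ioc 0 T)) : u T 0 = 0 := by
  refine eq_zero_of_sub_sin_mul_cos_eq_zero ?_
  by_contra hne
  have hw : ContinuousAt (fun r => (u T r - sin (u T r) * cos (u T r)) ^ 2) 0 := by fun_prop
  set c := (u T 0 - sin (u T 0) * cos (u T 0)) ^ 2 with hcdef
  have hc0 : 0 < c := by positivity
  have hev : ∀ᶠ r in 𝓝 0, c / 2 < (u T r - sin (u T r) * cos (u T r)) ^ 2 :=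
    hw.eventually (lt_mem_nhds (by simp only [← hcdef]; linarith))
  have hev1 : ∀ᶠ r : ℝ in 𝓝 0, |r| < 1 :=
    continuous_abs.continuousAt.eventually (gt_mem_nhds (by simp))
  refine not_intervalIntegrable_of_sub_inv_isBigO_punctured
    (f := fun r => eDens u T r * r ^ 2) (c := 0) (a := 0) (b := T) ?_ hT.ne left_mem_uIcc
    ((intervalIntegrable_iff_integrableOn_Ioc_of_le hT.le).2 hi)
  refine Asymptotics.IsBigO.of_bound (4 / c) ?_
  filter_upwards [hev.filter_mono nhdsWithin_le_nhds, hev1.filter_mono nhdsWithin_le_nhds,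
    self_mem_nhdsWithin] with r h1 h2 h3
  have hr : 0 < |r| := abs_pos.2 h3
  have hr2 : r ^ 2 = |r| ^ 2 := (sq_abs r).symm
  have hr4 : r ^ 4 = |r| ^ 4 := ((by decide : Even 4).pow_abs r).symm
  have hlow : c / 4 * |r|⁻¹ ≤ eDens u T r * r ^ 2 := by
    calc c / 4 * |r|⁻¹ ≤ c / 4 * (|r| ^ 2)⁻¹ := by
          gcongr
          nlinarith
      _ = (c / 2) / (2 * r ^ 4) * r ^ 2 := by
          rw [hr4, hr2]; field_simp; norm_num
      _ ≤ (u T r - sin (u T r) * cos (u T r)) ^ 2 / (2 * r ^ 4) * r ^ 2 := by gcongr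
      _ ≤ eDens u T r * r ^ 2 := by
          unfold eDens
          gcongr
          rw [le_add_iff_nonneg_left]
          positivity
  rw [sub_zero, norm_inv, Real.norm_eq_abs,
    Real.norm_of_nonneg (mul_nonneg (eDens_nonneg u T r) (sq_nonneg r))]
  calc |r|⁻¹ = 4 / c * (c / 4 * |r|⁻¹) := by field_simp
    _ ≤ _ := by gcongr

/-- The singular terms of the equation force `u(t, 0)` to be a multiple of `π`. -/
lemma sin_origin_eq_zero {u : ℝ → ℝ → ℝ} {V : Set (ℝ × ℝ)} {t : ℝ} (hV : IsOpen V)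
    (hu : ContDiffOn ℝ (⊤ : ℕ∞) (fun p : ℝ × ℝ => u p.1 p.2) V) (hp : (t, 0) ∈ V)
    (heq : ∀ᶠ r in 𝓝[>] 0, ANeq u t r) : sin (u t 0) = 0 := by
  have cu : ContinuousAt (fun r => u t r) 0 := (hasDerivAt_ur hV hu hp).continuousAt
  have cur : ContinuousAt (fun r => ur u t r) 0 :=
    (hasDerivAt_ur hV (contDiffOn_ur hV hu) hp).continuousAt
  have curr : ContinuousAt (fun r => urr u t r) 0 :=
    (hasDerivAt_ur hV (contDiffOn_ur hV (contDiffOn_ur hV hu)) hp).continuousAt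
  have cutt : ContinuousAt (fun r => utt u t r) 0 :=
    (hasDerivAt_ur hV (contDiffOn_ut hV (contDiffOn_ut hV hu)) hp).continuousAt
  have hc : ContinuousAt (fun r => r ^ 4 * (utt u t r - urr u t r) - 2 * r ^ 3 * ur u t r +
      r ^ 2 * sin (2 * u t r) +
      (u t r - sin (u t r) * cos (u t r)) * (1 - cos (2 * u t r))) 0 := by fun_prop
  have h0 := tendsto_nhds_unique_of_eventuallyEq (hc.tendsto.mono_left nhdsWithin_le_nhds)
    (tendsto_const_nhds (x := (0 : ℝ)) (f := 𝓝[>] 0)) (by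
      filter_upwards [heq, self_mem_nhdsWithin] with r h hr
      have hr : r ≠ 0 := (mem_Ioi.1 hr).ne'
      unfold ANeq at h
      field_simp at h
      linear_combination h)
  simp only [ne_eq, OfNat.ofNat_ne_zero, not_false_eq_true, zero_pow, mul_zero, zero_mul, sub_zero,
    zero_add, mul_eq_zero] at h0
  rcases h0 with h | h
  · rw [eq_zero_of_sub_sin_mul_cos_eq_zero h, sin_zero]
  · rw [cos_two_mul] at h
    nlinarith [sin_sq_add_cos_sq (u t 0)]

/-- A continuous function with values in `πℤ` which vanishes somewhere on an interval vanishes at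
the other end point. -/
lemma eq_zero_of_sin_comp_eq_zero {v : ℝ → ℝ} {a b : ℝ} (hv : ContinuousOn v (uIcc a b))
    (hs : ∀ x ∈ uIcc a b, sin (v x) = 0) (hb : v b = 0) : v a = 0 := by
  have hivt := intermediate_value_uIcc hv
  rw [hb] at hivt
  rcases lt_trichotomy (v a) 0 with h | h | h
  · obtain ⟨x, hx, hxv⟩ := hivt (show max (v a) (-(π / 2)) ∈ uIcc (v a) 0 by
      rw [uIcc_of_le h.le]
      exact ⟨le_max_left _ _, max_le h.le (by linarith [pi_pos])⟩)
    have := sin_neg_of_neg_of_neg_pi_lt (x := v x)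
      (by rw [hxv]; exact max_lt h (by linarith [pi_pos]))
      (by rw [hxv]; exact lt_max_of_lt_right (by linarith [pi_pos]))
    exact absurd (hs x hx) this.ne
  · exact h
  · obtain ⟨x, hx, hxv⟩ := hivt (show min (v a) (π / 2) ∈ uIcc (v a) 0 by
      rw [uIcc_of_ge h.le]
      exact ⟨le_min h.le (by linarith [pi_pos]), min_le_left _ _⟩)
    have := sin_pos_of_pos_of_lt_pi (x := v x)
      (by rw [hxv]; exact lt_min h (by linarith [pi_pos]))
      (by rw [hxv]; exact min_lt_of_right_lt (by linarith [pi_pos]))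
    exact absurd (hs x hx) this.ne'

lemma BackwardFramework.origin_eq_zero {u : ℝ → ℝ → ℝ} {T t : ℝ} (h : BackwardFramework u T)
    (ht : 0 < t) (htT : t ≤ T) : u t 0 = 0 := by
  obtain ⟨hT, ⟨V, hV, hDV, hu⟩, heq, hi⟩ := h
  have hmem : ∀ s ∈ uIcc t T, (s, (0 : ℝ)) ∈ V := by
    intro s hs
    rw [uIcc_of_le htT] at hs
    exact hDV (mem_Dom (ht.trans_le hs.1) hs.2 le_rfl (ht.trans_le hs.1).le)
  refine eq_zero_of_sin_comp_eq_zero (v := fun s => u s 0) (b := T)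
    (fun s hs => (hasDerivAt_ut hV hu (hmem s hs)).continuousAt.continuousWithinAt) ?_
    (origin_eq_zero_of_integrableOn hT
      (hasDerivAt_ur hV hu (hmem T right_mem_uIcc)).continuousAt hi)
  intro s hs
  refine sin_origin_eq_zero hV hu (hmem s hs) ?_
  rw [uIcc_of_le htT] at hs
  have hs0 : 0 < s := ht.trans_le hs.1
  filter_upwards [Ioo_mem_nhdsGT hs0] with r hr
  exact heq (s, r) (mem_Dom hs0 hs.2 hr.1.le hr.2.le) hr.1

/-- The energy density is continuously differentiable away from the axis `r = 0`. -/
lemma contDiffOn_eDens {u : ℝ → ℝ → ℝ} {V : Set (ℝ × ℝ)} (hV : IsOpen V)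
    (hu : ContDiffOn ℝ (⊤ : ℕ∞) (fun p : ℝ × ℝ => u p.1 p.2) V) :
    ContDiffOn ℝ (⊤ : ℕ∞) (fun p : ℝ × ℝ => eDens u p.1 p.2 * p.2 ^ 2)
      (V ∩ {p : ℝ × ℝ | p.2 ≠ 0}) := by
  have h0 := hu.mono (inter_subset_left (t := {p : ℝ × ℝ | p.2 ≠ 0}))
  have h1 := (contDiffOn_ut hV hu).mono (inter_subset_left (t := {p : ℝ × ℝ | p.2 ≠ 0}))
  have h2 := (contDiffOn_ur hV hu).mono (inter_subset_left (t := {p : ℝ × ℝ | p.2 ≠ 0}))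
  have h3 : ContDiffOn ℝ (⊤ : ℕ∞) (fun p : ℝ × ℝ => p.2) (V ∩ {p : ℝ × ℝ | p.2 ≠ 0}) :=
    contDiffOn_snd
  unfold eDens
  refine ((((contDiffOn_const.mul ((h1.pow 2).add (h2.pow 2))).add
    ((h0.sin.pow 2).div (h3.pow 2) ?_)).add
    (((h0.sub (h0.sin.mul h0.cos)).pow 2).div (contDiffOn_const.mul (h3.pow 4)) ?_))).mul (h3.pow 2)
  · exact fun p hp => pow_ne_zero 2 hp.2
  · exact fun p hp => mul_ne_zero two_ne_zero (pow_ne_zero 4 hp.2)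

/-- The local energy identity `∂ₜ (r² e) = ∂ᵣ (r² u_t u_r)`. -/
lemma ut_eDens_eq_ur_momentum {u : ℝ → ℝ → ℝ} {V : Set (ℝ × ℝ)} {t r : ℝ} (hV : IsOpen V)
    (hu : ContDiffOn ℝ (⊤ : ℕ∞) (fun p : ℝ × ℝ => u p.1 p.2) V) (hp : (t, r) ∈ V) (hr : r ≠ 0)
    (heq : ANeq u t r) :
    ut (fun t r => eDens u t r * r ^ 2) t r = ur (fun t r => r ^ 2 * (ut u t r * ur u t r)) t r := by
  have d0 := hasDerivAt_ut hV hu hp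
  have d1 : HasDerivAt (fun s => ut u s r) (utt u t r) t :=
    hasDerivAt_ut hV (contDiffOn_ut hV hu) hp
  have d2 := hasDerivAt_ut hV (contDiffOn_ur hV hu) hp
  have d3 := hasDerivAt_ur hV (contDiffOn_ut hV hu) hp
  have d4 : HasDerivAt (fun s => ur u t s) (urr u t r) r :=
    hasDerivAt_ur hV (contDiffOn_ur hV hu) hp
  rw [ut_ur_comm hV hu hp] at d2
  have hl := (((((d1.pow 2).add (d2.pow 2)).const_mul (1 / 2)).add
    ((d0.sin.pow 2).div_const (r ^ 2))).add
    (((d0.sub (d0.sin.mul d0.cos)).pow 2).div_const (2 * r ^ 4))).mul_const (r ^ 2)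
  have hr' := ((hasDerivAt_id r).pow 2).mul (d3.mul d4)
  refine Eq.trans (hl.deriv : ut (fun t r => eDens u t r * r ^ 2) t r = _)
    (Eq.trans ?_ (hr'.deriv : ur (fun t r => r ^ 2 * (ut u t r * ur u t r)) t r = _).symm)
  have htt : utt u t r = urr u t r + (2 / r) * ur u t r - sin (2 * u t r) / r ^ 2 -
      (u t r - sin (u t r) * cos (u t r)) * (1 - cos (2 * u t r)) / r ^ 4 := by
    unfold ANeq at heq; linarith
  have hsc : sin (u t r) ^ 2 = 1 - cos (u t r) ^ 2 := sin_sq _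
  rw [htt, sin_two_mul, cos_two_mul]
  simp only [id, Pi.pow_apply, Pi.mul_apply, Pi.sub_apply]
  norm_num only [Nat.cast_ofNat, pow_one]
  field_simp
  linear_combination ut u t r * (u t r - sin (u t r) * cos (u t r)) * hsc

/-- The energy is finite at every time of the backward framework. -/
lemma BackwardFramework.integrableOn_eDens {u : ℝ → ℝ → ℝ} {T t : ℝ} (h : BackwardFramework u T)
    (ht : 0 < t) (htT : t ≤ T) : IntegrableOn (fun r => eDens u t r * r ^ 2) (Icc 0 t) := by
  have hu0 := h.origin_eq_zero ht htT
  obtain ⟨hT, ⟨V, hV, hDV, hu⟩, -, -⟩ := h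
  have hmem : ∀ r ∈ Icc 0 t, (t, r) ∈ V := fun r hr => hDV (mem_Dom ht htT hr.1 hr.2)
  have cut : ContinuousOn (fun r => ut u t r) (Icc 0 t) := fun r hr =>
    (hasDerivAt_ur hV (contDiffOn_ut hV hu) (hmem r hr)).continuousAt.continuousWithinAt
  have cur : ContinuousOn (fun r => ur u t r) (Icc 0 t) := fun r hr =>
    (hasDerivAt_ur hV (contDiffOn_ur hV hu) (hmem r hr)).continuousAt.continuousWithinAt
  obtain ⟨A, hA⟩ := (isCompact_Icc (a := (0 : ℝ)) (b := t)).exists_bound_of_continuousOn cut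
  obtain ⟨B, hB⟩ := (isCompact_Icc (a := (0 : ℝ)) (b := t)).exists_bound_of_continuousOn cur
  have hlin : ∀ r ∈ Icc 0 t, |u t r| ≤ B * r := by
    intro r hr
    have := (convex_Icc (0 : ℝ) t).norm_image_sub_le_of_norm_hasDerivWithin_le
      (f := fun r => u t r)
      (fun x hx => (hasDerivAt_ur hV hu (hmem x hx)).hasDerivWithinAt) hB
      (left_mem_Icc.2 ht.le) hr
    simpa [hu0, abs_of_nonneg hr.1] using this
  have hcont : ContinuousOn (fun r => eDens u t r * r ^ 2) (Ioc 0 t) := fun r hr => by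
    have hVr : V ∩ {p : ℝ × ℝ | p.2 ≠ 0} ∈ 𝓝 (t, r) :=
      (hV.inter (isOpen_ne_fun continuous_snd continuous_const)).mem_nhds
        ⟨hmem r (Ioc_subset_Icc_self hr), hr.1.ne'⟩
    exact (((contDiffOn_eDens hV hu).contDiffAt hVr).continuousAt.comp
      (f := fun r : ℝ => (t, r)) (by fun_prop)).continuousWithinAt
  rw [integrableOn_Icc_iff_integrableOn_Ioc]
  refine IntegrableOn.of_bound (C := t ^ 2 * (A ^ 2 + B ^ 2) + 1 + 2 * B ^ 2)
    (by simp) (hcont.aestronglyMeasurable measurableSet_Ioc) ?_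
  · refine (ae_restrict_iff' measurableSet_Ioc).2 (Eventually.of_forall fun r hr => ?_)
    have hr' := Ioc_subset_Icc_self hr
    have hr0 : 0 < r := hr.1
    rw [Real.norm_of_nonneg (mul_nonneg (eDens_nonneg u t r) (sq_nonneg r))]
    have h1 : ut u t r ^ 2 ≤ A ^ 2 := sq_le_sq' (abs_le.1 (hA r hr')).1 (abs_le.1 (hA r hr')).2
    have h2 : ur u t r ^ 2 ≤ B ^ 2 := sq_le_sq' (abs_le.1 (hB r hr')).1 (abs_le.1 (hB r hr')).2
    have h3 : u t r ^ 2 ≤ (B * r) ^ 2 :=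
      sq_le_sq' (abs_le.1 (hlin r hr')).1 (abs_le.1 (hlin r hr')).2
    have h4 : r ^ 2 ≤ t ^ 2 := pow_le_pow_left₀ hr0.le hr.2 2
    calc eDens u t r * r ^ 2 = r ^ 2 * ((1 / 2) * (ut u t r ^ 2 + ur u t r ^ 2)) +
          sin (u t r) ^ 2 + (u t r - sin (u t r) * cos (u t r)) ^ 2 / (2 * r ^ 2) := by
          unfold eDens; field_simp
      _ ≤ t ^ 2 * (A ^ 2 + B ^ 2) + 1 + 4 * (B * r) ^ 2 / (2 * r ^ 2) := by
          gcongr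
          · linarith [sq_nonneg (ut u t r), sq_nonneg (ur u t r)]
          · exact sin_sq_le_one _
          · exact (sq_sub_sin_mul_cos_le _).trans (by linarith)
      _ = t ^ 2 * (A ^ 2 + B ^ 2) + 1 + 2 * B ^ 2 := by field_simp; ring

lemma tendsto_integral_eDens {u : ℝ → ℝ → ℝ} {t : ℝ} (ht : 0 < t)
    (hi : IntegrableOn (fun r => eDens u t r * r ^ 2) (Icc 0 t)) :
    Tendsto (fun ε => ∫ r in ε..t, eDens u t r * r ^ 2) (𝓝[>] 0) (𝓝 (locE u t)) := by
  have hc := intervalIntegral.continuousOn_primitive_interval_left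
    (μ := volume) (f := fun r => eDens u t r * r ^ 2) (a := 0) (b := t) (by rwa [uIcc_of_le ht.le])
  rw [uIcc_of_le ht.le] at hc
  exact (hc 0 (left_mem_Icc.2 ht.le)).mono_left
    (nhdsWithin_le_iff.2 (mem_of_superset (Ioc_mem_nhdsGT ht) Ioc_subset_Icc_self))

/-- Monotonicity of the energy outside `r = ε`, up to the flux through `r = ε`. -/
lemma BackwardFramework.integral_eDens_le {u : ℝ → ℝ → ℝ} {T t₀ t₁ ε C : ℝ}
    (h : BackwardFramework u T) (hε : 0 < ε) (hε₀ : ε ≤ t₀) (ht : t₀ ≤ t₁) (htT : t₁ ≤ T)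
    (hC : ∀ t ∈ Icc t₀ t₁, |ut u t ε * ur u t ε| ≤ C) :
    (∫ r in ε..t₀, eDens u t₀ r * r ^ 2) ≤
      (∫ r in ε..t₁, eDens u t₁ r * r ^ 2) + ε ^ 2 * C * (t₁ - t₀) := by
  obtain ⟨hT, ⟨V, hV, hDV, hu⟩, heq, -⟩ := h
  have hD : ∀ t ∈ Icc t₀ t₁, ∀ r ∈ Icc ε t, (t, r) ∈ Dom T := fun t ht' r hr =>
    mem_Dom (by linarith [ht'.1]) (ht'.2.trans htT) (by linarith [hr.1]) hr.2
  have hg : ∀ t ∈ Icc t₀ t₁, ∀ r ∈ Icc ε t,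
      DifferentiableAt ℝ (fun p : ℝ × ℝ => eDens u p.1 p.2 * p.2 ^ 2) (t, r) := fun t ht' r hr =>
    ((contDiffOn_eDens hV hu).contDiffAt
      ((hV.inter (isOpen_ne_fun continuous_snd continuous_const)).mem_nhds
        ⟨hDV (hD t ht' r hr), (hε.trans_le hr.1).ne'⟩)).differentiableAt (by simp)
  have hh : ∀ t ∈ Icc t₀ t₁, ∀ r ∈ Icc ε t,
      DifferentiableAt ℝ (fun p : ℝ × ℝ => p.2 ^ 2 * (ut u p.1 p.2 * ur u p.1 p.2)) (t, r) :=
    fun t ht' r hr => (((contDiffOn_snd.pow 2).mul ((contDiffOn_ut hV hu).mul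
      (contDiffOn_ur hV hu))).contDiffAt (hV.mem_nhds (hDV (hD t ht' r hr)))).differentiableAt
      (n := (⊤ : ℕ∞)) (by simp)
  have key := integral_trapezoid_of_conservation hε₀ ht hg hh (fun t ht' r hr => by
    have hr0 := hε.trans_le hr.1
    have e1 : ut (fun t r => eDens u t r * r ^ 2) t r = _ :=
      ((hg t ht' r hr).hasFDerivAt.hasDerivAt_fst
        (F := fun t r => eDens u t r * r ^ 2)).deriv
    have e2 : ur (fun t r => r ^ 2 * (ut u t r * ur u t r)) t r = _ :=
      ((hh t ht' r hr).hasFDerivAt.hasDerivAt_snd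
        (F := fun t r => r ^ 2 * (ut u t r * ur u t r))).deriv
    rw [← e1, ← e2]
    exact ut_eDens_eq_ur_momentum hV hu (hDV (hD t ht' r hr)) hr0.ne' (heq _ (hD t ht' r hr) hr0))
  dsimp only at key
  have hpos : 0 ≤ ∫ t in t₀..t₁, (eDens u t t * t ^ 2 + t ^ 2 * (ut u t t * ur u t t)) := by
    refine intervalIntegral.integral_nonneg ht fun t _ => ?_
    have : eDens u t t + ut u t t * ur u t t = (1 / 2) * (ut u t t + ur u t t) ^ 2 +
        sin (u t t) ^ 2 / t ^ 2 + (u t t - sin (u t t) * cos (u t t)) ^ 2 / (2 * t ^ 4) := by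
      unfold eDens; ring
    rw [mul_comm, ← mul_add, this]
    positivity
  have hflux : ∫ t in t₀..t₁, ε ^ 2 * (ut u t ε * ur u t ε) ≤ ε ^ 2 * C * (t₁ - t₀) := by
    refine (Real.le_norm_self _).trans ?_
    rw [← abs_of_nonneg (sub_nonneg.2 ht)]
    refine intervalIntegral.norm_integral_le_of_norm_le_const fun t ht' => ?_
    rw [uIoc_of_le ht] at ht'
    rw [norm_mul, Real.norm_of_nonneg (sq_nonneg ε)]
    exact mul_le_mul_of_nonneg_left (hC t (Ioc_subset_Icc_self ht')) (sq_nonneg ε)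
  linarith

/-- Monotonicity of the local energy in the backward framework:
`E(t₀) ≤ E(t₁)` for `0 < t₀ ≤ t₁ ≤ T̄`. -/
theorem locE_monotone (u : ℝ → ℝ → ℝ) (Tbar : ℝ) (h : BackwardFramework u Tbar) :
    ∀ t₀ t₁ : ℝ, 0 < t₀ → t₀ ≤ t₁ → t₁ ≤ Tbar → locE u t₀ ≤ locE u t₁ := by
  intro t₀ t₁ h0 h01 h1
  have ht₁ : 0 < t₁ := h0.trans_le h01
  obtain ⟨V, hV, hDV, hu⟩ := h.2.1
  have hK : Icc t₀ t₁ ×ˢ Icc 0 t₀ ⊆ V := by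
    rintro ⟨t, r⟩ ⟨ht, hr⟩
    exact hDV (mem_Dom (h0.trans_le ht.1) (ht.2.trans h1) hr.1 (hr.2.trans ht.1))
  obtain ⟨C, hC⟩ := (isCompact_Icc.prod isCompact_Icc).exists_bound_of_continuousOn
    (((contDiffOn_ut hV hu).continuousOn.mul (contDiffOn_ur hV hu).continuousOn).mono hK)
  have herr : Tendsto (fun ε : ℝ => ε ^ 2 * C * (t₁ - t₀)) (𝓝[>] 0) (𝓝 0) := by
    have : Continuous fun ε : ℝ => ε ^ 2 * C * (t₁ - t₀) := by fun_prop
    simpa using (this.tendsto 0).mono_left nhdsWithin_le_nhds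
  have hlim := (tendsto_integral_eDens ht₁ (h.integrableOn_eDens ht₁ h1)).add herr
  rw [add_zero] at hlim
  refine le_of_tendsto_of_tendsto
    (tendsto_integral_eDens h0 (h.integrableOn_eDens h0 (h01.trans h1))) hlim ?_
  filter_upwards [Ioc_mem_nhdsGT h0] with ε hε
  exact h.integral_eDens_le hε.1 hε.2 h01 h1 fun t ht => hC (t, ε) ⟨ht, hε.1.le, hε.2⟩
end
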